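/- arXiv:2111.12387 — 3 statements merged into one kernel-verified Lean document; each statement's English description precedes it below -/
import Mathlib

section
/- Let D = (V, A) be a skeletal directed acyclic graph. The map sending a rope ρ = (u, v, Δ, ∇) of D to the set I_∨(ρ) = {(w,w') ∈ A : w ∈ ∇ ∪ {u} and w' ∈ Δ ∪ {v}} is a bijection from the ropes of D onto the join irreducible elements of the lattice AR(D). Its inverse sends a join irreducible B ∈ AR(D), whose unique reversed arc in the transitive reduction of E_B is (u,v), to the rope (u, v, Δ^B_{u,v}, ∇^B_{u,v}). -/
def ArcRel {V : Type*} (E : Set (V × V)) : V → V → Prop := fun x y => (x, y) ∈ E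

/-- `E` has no directed cycle. -/
def AcyclicArcs {V : Type*} (E : Set (V × V)) : Prop :=
  ∀ v : V, ¬ Relation.TransGen (ArcRel E) v v

/-- `A` is the arc set of a directed acyclic graph: arcs join distinct vertices,
at most one direction between two vertices, and no directed cycle. -/
def IsDAG {V : Type*} (A : Set (V × V)) : Prop :=
  (∀ a ∈ A, a.1 ≠ a.2) ∧ (∀ a ∈ A, Prod.swap a ∉ A) ∧ AcyclicArcs A

/-- Arc set of the reorientation of `A` where exactly the arcs of `B` are reversed. -/
def reorient {V : Type*} (A B : Set (V × V)) : Set (V × V) :=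
  (A \ B) ∪ (Prod.swap '' B)

/-- `B` encodes an acyclic reorientation of `A`. -/
def ARmem {V : Type*} (A B : Set (V × V)) : Prop :=
  B ⊆ A ∧ AcyclicArcs (reorient A B)

/-- The acyclic reorientation poset of `A`, ordered by inclusion of reversed sets. -/
abbrev ARP {V : Type*} (A : Set (V × V)) := {B : Set (V × V) // ARmem A B}

/-- Transitive reduction: delete every arc whose endpoints are joined by a
directed path of length at least 2. -/
def transRed {V : Type*} (E : Set (V × V)) : Set (V × V) :=
  {a ∈ E | ¬ ∃ w : V, ArcRel E a.1 w ∧ Relation.TransGen (ArcRel E) w a.2}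

/-- Underlying undirected graph of an arc set. -/
def undirectedGraph {V : Type*} (E : Set (V × V)) : SimpleGraph V :=
  SimpleGraph.fromRel (fun x y => (x, y) ∈ E)

/-- A directed graph is a forest if its underlying undirected graph has no cycle. -/
def IsForestArcs {V : Type*} (E : Set (V × V)) : Prop :=
  (undirectedGraph E).IsAcyclic

def inducedArcs {V : Type*} (A : Set (V × V)) (U : Set V) : Set (V × V) :=
  {a ∈ A | a.1 ∈ U ∧ a.2 ∈ U}

/-- The transitive reduction of any induced subgraph is a forest. -/
def Vertebrate {V : Type*} (A : Set (V × V)) : Prop :=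
  ∀ U : Set V, IsForestArcs (transRed (inducedArcs A U))

/-- For every directed path from `u` to `v` with `(u,v) ∈ A`, any two vertices of
the path are joined by an arc of `A`. -/
def Filled {V : Type*} (A : Set (V × V)) : Prop :=
  ∀ p : List V, p.Chain' (fun x y => (x, y) ∈ A) →
    ∀ u v : V, p.head? = some u → p.getLast? = some v → (u, v) ∈ A →
      ∀ x ∈ p, ∀ y ∈ p, x ≠ y → ((x, y) ∈ A ∨ (y, x) ∈ A)

def Skeletal {V : Type*} (A : Set (V × V)) : Prop := Vertebrate A ∧ Filled A

/-- Vertices lying on some directed path in `A` from `u` to `v` (including `u` and `v`). -/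
def transSupport {V : Type*} (A : Set (V × V)) (u v : V) : Set V :=
  {w : V | Relation.ReflTransGen (ArcRel A) u w ∧ Relation.ReflTransGen (ArcRel A) w v}

/-- Data of a quadruple `(u, v, Δ, ∇)`. -/
structure RopeData (V : Type*) where
  u : V
  v : V
  down : Set V
  up : Set V

/-- A rope of `A`: `(u,v) ∈ A` and `Δ, ∇` are disjoint sets whose union is the
transitive support of `(u,v)` minus `{u, v}`. -/
def IsRope {V : Type*} (A : Set (V × V)) (r : RopeData V) : Prop :=
  (r.u, r.v) ∈ A ∧ r.down ∩ r.up = ∅ ∧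
    r.down ∪ r.up = transSupport A r.u r.v \ {r.u, r.v}

def deltaDown {V : Type*} (A B : Set (V × V)) (u v : V) : Set V :=
  {w : V | (u, w) ∈ B ∧ (w, v) ∈ A \ B}

def deltaUp {V : Type*} (A B : Set (V × V)) (u v : V) : Set V :=
  {w : V | (u, w) ∈ A \ B ∧ (w, v) ∈ B}

/-- The join irreducible acyclic reorientation associated to a rope
`(u, v, Δ, ∇)`: the arcs `(w,w')` of `A` with `w ∈ ∇ ∪ {u}` and `w' ∈ Δ ∪ {v}`. -/
def Ijoin {V : Type*} (A : Set (V × V)) (r : RopeData V) : Set (V × V) :=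
  {a ∈ A | a.1 ∈ r.up ∪ {r.u} ∧ a.2 ∈ r.down ∪ {r.v}}

/-- `B` is a join irreducible element of `AR(A)`: it covers exactly one element. -/
def JoinIrrAR {V : Type*} (A B : Set (V × V)) : Prop :=
  ARmem A B ∧ ∃! C : Set (V × V), ARmem A C ∧ C ⊆ B ∧ C ≠ B ∧
    ∀ E, ARmem A E → C ⊆ E → E ⊆ B → E = C ∨ E = B

open Relation

theorem tg_mono {V : Type*} {r p : V → V → Prop} {a b : V} (h : TransGen r a b)
    (hrp : ∀ a b, r a b → p a b) : TransGen p a b := by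
  induction h with
  | single h => exact .single (hrp _ _ h)
  | tail _ h ih => exact .tail ih (hrp _ _ h)

theorem rtg_mono {V : Type*} {r p : V → V → Prop} {a b : V} (h : ReflTransGen r a b)
    (hrp : ∀ a b, r a b → p a b) : ReflTransGen p a b := by
  induction h with
  | refl => exact .refl
  | tail _ h ih => exact .tail ih (hrp _ _ h)

theorem leaf_exists {V : Type*} [Finite V] {G : SimpleGraph V} (hG : G.IsAcyclic) {a b : V}
    (hab : G.Adj a b) : ∃ x y, G.Adj x y ∧ ∀ z, G.Adj x z → z = y := by
  classical
  have : Nonempty V := ⟨a⟩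
  obtain ⟨u, v, p, hp, hmax⟩ := SimpleGraph.Walk.exists_isPath_forall_isPath_length_le_length G
  have h1 : 1 ≤ p.length := by
    have := hmax a b (SimpleGraph.Walk.cons hab SimpleGraph.Walk.nil) (by simp [hab.ne])
    simpa using this
  have hnn : ¬ p.Nil := by
    intro h
    have := SimpleGraph.Walk.nil_iff_length_eq.mp h
    omega
  refine ⟨u, p.snd, p.adj_snd hnn, fun z hz => ?_⟩
  apply hG.eq_snd_of_adj_start hp hz
  by_contra hns
  have := hmax z v (SimpleGraph.Walk.cons hz.symm p) (by
    rw [SimpleGraph.Walk.cons_isPath_iff]; exact ⟨hp, hns⟩)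
  simp at this

def Rst {V : Type*} (R : V → V → Prop) (U : Set V) : V → V → Prop :=
  fun x y => R x y ∧ x ∈ U ∧ y ∈ U

theorem first_hit {V : Type*} {R : V → V → Prop} {U : Set V} {x y : V}
    (h : TransGen (Rst R U) y x) (hne : y ≠ x) :
    ∃ p, ReflTransGen (Rst R (U \ {x})) y p ∧ Rst R U p x := by
  induction h using TransGen.head_induction_on with
  | single h => exact ⟨_, .refl, h⟩
  | @head a c hac _ ih =>
    by_cases hc : c = x
    · subst hc; exact ⟨a, .refl, hac⟩
    · obtain ⟨p, hp, hpx⟩ := ih hc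
      exact ⟨p, .head ⟨hac.1, ⟨hac.2.1, hne⟩, ⟨hac.2.2, hc⟩⟩ hp, hpx⟩

theorem last_hit {V : Type*} {R : V → V → Prop} {U : Set V} {x y : V}
    (h : TransGen (Rst R U) x y) (hne : y ≠ x) :
    ∃ p, Rst R U x p ∧ ReflTransGen (Rst R (U \ {x})) p y := by
  induction h with
  | single h => exact ⟨_, h, .refl⟩
  | @tail c a _ hca ih =>
    by_cases hc : c = x
    · subst hc; exact ⟨a, hca, .refl⟩
    · obtain ⟨p, hp, hpx⟩ := ih hc
      exact ⟨p, hp, .tail hpx ⟨hca.1, ⟨hca.2.1, hc⟩, ⟨hca.2.2, hne⟩⟩⟩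

theorem acyc_abs {V : Type*} [Finite V] (R : V → V → Prop)
    (asym : ∀ x y, R x y → ¬ R y x)
    (tri : ∀ x y z, R x y → R y z → R z x → False)
    (dom : ∀ U : Set V, (∃ a ∈ U, ∃ b ∈ U, R a b) → ∃ x ∈ U, ∃ y ∈ U, (R x y ∨ R y x) ∧
      ∀ z ∈ U, (R x z ∨ R z x) → z ≠ y → (R y z ∨ R z y)) :
    ∀ v, ¬ TransGen R v v := by
  intro v0 hv0
  let P : Set V → Prop := fun U => ∃ v, TransGen (Rst R U) v v
  have hP : P Set.univ := ⟨v0, tg_mono hv0 fun a b h => ⟨h, trivial, trivial⟩⟩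
  obtain ⟨U, -, hU⟩ := exists_minimal_le_of_wellFoundedLT P Set.univ hP
  obtain ⟨v, hv⟩ := hU.prop
  have hconn : ∀ a ∈ U, ∀ b ∈ U, TransGen (Rst R U) a b := by
    let U' : Set V := {w | TransGen (Rst R U) v w ∧ TransGen (Rst R U) w v}
    have hsub : U' ⊆ U := by
      rintro w ⟨h1, h2⟩
      obtain ⟨c, hc, -⟩ := TransGen.head'_iff.mp h2
      exact hc.2.1
    have hvU : v ∈ U' := ⟨hv, hv⟩
    have key : ∀ w, TransGen (Rst R U) v w → TransGen (Rst R U) w v →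
        TransGen (Rst R U') v w := by
      intro w h1
      induction h1 with
      | single h => exact fun h2 => .single ⟨h.1, hvU, .single h, h2⟩
      | @tail b c h1 h ih =>
        intro h2
        have hb : TransGen (Rst R U) b v := .head h h2
        exact .tail (ih hb) ⟨h.1, ⟨h1, hb⟩, ⟨h1.tail h, h2⟩⟩
    have : U ≤ U' := hU.le_of_le ⟨v, key v hv hv⟩ hsub
    intro a ha b hb
    exact (this ha).2.trans (this hb).1
  have hmin : ∀ x ∈ U, ∀ w, ¬ TransGen (Rst R (U \ {x})) w w := by
    intro x hx w hw
    have : U ≤ U \ {x} := hU.le_of_le ⟨w, hw⟩ Set.sdiff_subset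
    exact (this hx).2 rfl
  obtain ⟨c, hc, -⟩ := TransGen.head'_iff.mp hv
  obtain ⟨x, hx, y, hy, hxy, hd⟩ := dom U ⟨v, hc.2.1, c, hc.2.2, hc.1⟩
  have hne : y ≠ x := by
    rintro rfl
    rcases hxy with h | h <;> exact asym _ _ h h
  rcases hxy with hxy | hyx
  · obtain ⟨p, hp, hpx⟩ := first_hit (hconn y hy x hx) hne
    have hpy : p ≠ y := by rintro rfl; exact asym _ _ hxy hpx.1
    have hpx' : p ≠ x := by rintro rfl; exact asym _ _ hpx.1 hpx.1
    rcases hd p hpx.2.1 (.inr hpx.1) hpy with h | h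
    · exact tri _ _ _ hxy h hpx.1
    · exact hmin x hx y (TransGen.tail' hp ⟨h, ⟨hpx.2.1, hpx'⟩, ⟨hy, hne⟩⟩)
  · obtain ⟨p, hpx, hp⟩ := last_hit (hconn x hx y hy) hne
    have hpy : p ≠ y := by rintro rfl; exact asym _ _ hyx hpx.1
    have hpx' : p ≠ x := by rintro rfl; exact asym _ _ hpx.1 hpx.1
    rcases hd p hpx.2.2 (.inl hpx.1) hpy with h | h
    · exact hmin x hx y (TransGen.head' ⟨h, ⟨hy, hne⟩, ⟨hpx.2.2, hpx'⟩⟩ hp)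
    · exact tri _ _ _ hpx.1 h hyx

theorem transRed_gen {V : Type*} [Finite V] {E : Set (V × V)} (hE : AcyclicArcs E) :
    ∀ (n : ℕ) (x y : V), {w | TransGen (ArcRel E) x w ∧ TransGen (ArcRel E) w y}.ncard ≤ n →
      TransGen (ArcRel E) x y → TransGen (ArcRel (transRed E)) x y := by
  intro n
  induction n using Nat.strong_induction_on with
  | _ n ih =>
  intro x y hn hxy
  by_cases hw : ∃ w, TransGen (ArcRel E) x w ∧ TransGen (ArcRel E) w y
  · obtain ⟨w, h1, h2⟩ := hw
    have l1 : {z | TransGen (ArcRel E) x z ∧ TransGen (ArcRel E) z w}.ncard < n := by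
      refine lt_of_lt_of_le (Set.ncard_lt_ncard ?_ (Set.toFinite _)) hn
      exact ⟨fun z hz => ⟨hz.1, hz.2.trans h2⟩, fun hh => hE w (hh ⟨h1, h2⟩).2⟩
    have l2 : {z | TransGen (ArcRel E) w z ∧ TransGen (ArcRel E) z y}.ncard < n := by
      refine lt_of_lt_of_le (Set.ncard_lt_ncard ?_ (Set.toFinite _)) hn
      exact ⟨fun z hz => ⟨h1.trans hz.1, hz.2⟩, fun hh => hE w (hh ⟨h1, h2⟩).1⟩
    exact (ih _ l1 x w le_rfl h1).trans (ih _ l2 w y le_rfl h2)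
  · obtain ⟨c, hc, hcy⟩ := TransGen.head'_iff.mp hxy
    rcases reflTransGen_iff_eq_or_transGen.mp hcy with rfl | h
    · refine .single ⟨hc, ?_⟩
      rintro ⟨w, h1, h2⟩
      exact hw ⟨w, .single h1, h2⟩
    · exact absurd ⟨c, .single hc, h⟩ hw

theorem filled_arc {V : Type*} {A : Set (V × V)} (hA : IsDAG A) (hF : Filled A) {u w v : V}
    (huv : (u, v) ∈ A) (h1 : TransGen (ArcRel A) u w) (h2 : TransGen (ArcRel A) w v) :
    (u, w) ∈ A ∧ (w, v) ∈ A := by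
  have hac := hA.2.2
  obtain ⟨l1, hl1, hlast1⟩ := List.exists_isChain_cons_of_relationReflTransGen h1.to_reflTransGen
  obtain ⟨l2, hl2, hlast2⟩ := List.exists_isChain_cons_of_relationReflTransGen h2.to_reflTransGen
  have hne2 : l2 ≠ [] := by
    rintro rfl
    simp at hlast2
    subst hlast2
    exact hac _ h2
  have hchain : ((u :: l1) ++ l2).IsChain (fun x y => (x, y) ∈ A) := by
    rw [List.isChain_append]
    refine ⟨hl1, hl2.tail, ?_⟩
    intro x hx y hy
    rw [List.getLast?_eq_getLast_of_ne_nil (List.cons_ne_nil _ _), hlast1] at hx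
    simp at hx
    subst hx
    cases l2 with
    | nil => simp at hne2
    | cons c l =>
      simp at hy
      subst hy
      rw [List.isChain_cons_cons] at hl2
      exact hl2.1
  have hlast : ((u :: l1) ++ l2).getLast? = some v := by
    rw [List.getLast?_append_of_ne_nil _ hne2, List.getLast?_eq_getLast_of_ne_nil hne2]
    rw [List.getLast_cons hne2] at hlast2
    rw [hlast2]
  have hadj := hF ((u :: l1) ++ l2) hchain u v (by simp) hlast huv
  have hu : u ∈ (u :: l1) ++ l2 := by simp
  have hw : w ∈ (u :: l1) ++ l2 := by
    apply List.mem_append_left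
    rw [← hlast1]
    exact List.getLast_mem _
  have hv : v ∈ (u :: l1) ++ l2 := List.mem_of_getLast? hlast
  constructor
  · rcases hadj u hu w hw (by rintro rfl; exact hac _ h1) with h | h
    · exact h
    · exact absurd (h1.tail h) (hac _)
  · rcases hadj w hw v hv (by rintro rfl; exact hac _ h2) with h | h
    · exact h
    · exact absurd (h2.tail h) (hac _)

def Biclosed {V : Type*} (A B : Set (V × V)) : Prop :=
  B ⊆ A ∧ ∀ x y z, (x, y) ∈ A → (y, z) ∈ A → (x, z) ∈ A →
    ((x, y) ∈ B → (y, z) ∈ B → (x, z) ∈ B) ∧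
    ((x, z) ∈ B → (x, y) ∈ B ∨ (y, z) ∈ B)

theorem mem_reorient {V : Type*} {A B : Set (V × V)} {x y : V} :
    (x, y) ∈ reorient A B ↔ ((x, y) ∈ A ∧ (x, y) ∉ B) ∨ (y, x) ∈ B := by
  simp [reorient]

theorem biclosed_of_mem {V : Type*} {A B : Set (V × V)} (h : ARmem A B) : Biclosed A B := by
  refine ⟨h.1, fun x y z hxy hyz hxz => ⟨fun h1 h2 => ?_, fun h1 => ?_⟩⟩
  · by_contra h3
    have e1 : ArcRel (reorient A B) x z := mem_reorient.mpr (.inl ⟨hxz, h3⟩)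
    have e2 : ArcRel (reorient A B) z y := mem_reorient.mpr (.inr h2)
    have e3 : ArcRel (reorient A B) y x := mem_reorient.mpr (.inr h1)
    exact h.2 x (.head e1 (.head e2 (.single e3)))
  · by_contra h3
    push Not at h3
    have e1 : ArcRel (reorient A B) z x := mem_reorient.mpr (.inr h1)
    have e2 : ArcRel (reorient A B) x y := mem_reorient.mpr (.inl ⟨hxy, h3.1⟩)
    have e3 : ArcRel (reorient A B) y z := mem_reorient.mpr (.inl ⟨hyz, h3.2⟩)
    exact h.2 z (.head e1 (.head e2 (.single e3)))

theorem mem_of_biclosed {V : Type*} [Finite V] {A B : Set (V × V)} (hA : IsDAG A)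
    (hS : Skeletal A) (h : Biclosed A B) : ARmem A B := by
  obtain ⟨hV, hF⟩ := hS
  obtain ⟨hirr, hasym, hac⟩ := hA
  have hirr' : ∀ x y, (x, y) ∈ A → x ≠ y := fun x y h => hirr _ h
  have hasym' : ∀ x y, (x, y) ∈ A → (y, x) ∉ A := fun x y h => hasym _ h
  have htri : ∀ x y z, (x, y) ∈ A → (y, z) ∈ A → (z, x) ∉ A := fun x y z h1 h2 h3 =>
    hac x (.head (b := y) h1 (.head (b := z) h2 (.single h3)))
  obtain ⟨hBA, hB⟩ := h
  refine ⟨hBA, ?_⟩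
  have hR : ∀ x y, ArcRel (reorient A B) x y ↔ ((x, y) ∈ A ∧ (x, y) ∉ B) ∨ (y, x) ∈ B :=
    fun x y => mem_reorient
  have hRadj : ∀ x y, (ArcRel (reorient A B) x y ∨ ArcRel (reorient A B) y x) ↔
      ((x, y) ∈ A ∨ (y, x) ∈ A) := by
    intro x y
    rw [hR, hR]
    have := @hBA (x, y)
    have := @hBA (y, x)
    tauto
  apply acyc_abs
  · intro x y h1 h2
    rw [hR] at h1 h2
    have := @hBA (x, y)
    have := @hBA (y, x)
    have := hasym' x y
    tauto
  · intro x y z h1 h2 h3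
    rw [hR] at h1 h2 h3
    have hB' : ∀ x y, (x, y) ∈ B → (x, y) ∈ A := fun x y h => hBA h
    grind
  · rintro U ⟨a, ha, b, hb, hab⟩
    have hacU : AcyclicArcs (inducedArcs A U) := fun v hv => hac v (tg_mono hv fun _ _ h => h.1)
    have hgen : ∀ x z, (x, z) ∈ inducedArcs A U →
        TransGen (ArcRel (transRed (inducedArcs A U))) x z :=
      fun x z h => transRed_gen hacU _ x z le_rfl (.single h)
    have hT : ∀ x y, ArcRel (transRed (inducedArcs A U)) x y → (x, y) ∈ A ∧ x ∈ U ∧ y ∈ U :=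
      fun x y h => h.1
    have hG : ∀ x y, (undirectedGraph (transRed (inducedArcs A U))).Adj x y ↔
        (ArcRel (transRed (inducedArcs A U)) x y ∨ ArcRel (transRed (inducedArcs A U)) y x) := by
      intro x y
      simp only [undirectedGraph, SimpleGraph.fromRel_adj, ArcRel]
      refine ⟨fun h => h.2, fun h => ⟨?_, h⟩⟩
      rcases h with h | h
      · exact hirr' _ _ (hT _ _ h).1
      · exact (hirr' _ _ (hT _ _ h).1).symm
    have hedge : ∃ a b, (undirectedGraph (transRed (inducedArcs A U))).Adj a b := by
      rcases (hRadj a b).mp (.inl hab) with h | h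
      · obtain ⟨c, hc, -⟩ := TransGen.head'_iff.mp (hgen a b ⟨h, ha, hb⟩)
        exact ⟨_, _, (hG _ _).mpr (.inl hc)⟩
      · obtain ⟨c, hc, -⟩ := TransGen.head'_iff.mp (hgen b a ⟨h, hb, ha⟩)
        exact ⟨_, _, (hG _ _).mpr (.inl hc)⟩
    obtain ⟨a', b', hab'⟩ := hedge
    obtain ⟨x, y, hxy, huniq⟩ := leaf_exists (hV U) hab'
    have hmono : ∀ {p q}, ReflTransGen (ArcRel (transRed (inducedArcs A U))) p q →
        ReflTransGen (ArcRel A) p q := fun h => rtg_mono h fun _ _ h => (hT _ _ h).1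
    have hout : ∀ z ∈ U, (x, z) ∈ A → (x, y) ∈ A ∧ ReflTransGen (ArcRel A) y z := by
      intro z hz hxz
      have hxU : x ∈ U := by
        rcases (hG _ _).mp hxy with h | h
        · exact (hT _ _ h).2.1
        · exact (hT _ _ h).2.2
      obtain ⟨c, hc, hcz⟩ := TransGen.head'_iff.mp (hgen x z ⟨hxz, hxU, hz⟩)
      have := huniq c ((hG _ _).mpr (.inl hc))
      subst this
      exact ⟨(hT _ _ hc).1, hmono hcz⟩
    have hin : ∀ z ∈ U, (z, x) ∈ A → (y, x) ∈ A ∧ ReflTransGen (ArcRel A) z y := by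
      intro z hz hxz
      have hxU : x ∈ U := by
        rcases (hG _ _).mp hxy with h | h
        · exact (hT _ _ h).2.1
        · exact (hT _ _ h).2.2
      obtain ⟨c, hcz, hc⟩ := TransGen.tail'_iff.mp (hgen z x ⟨hxz, hz, hxU⟩)
      have := huniq c ((hG _ _).mpr (.inr hc))
      subst this
      exact ⟨(hT _ _ hc).1, hmono hcz⟩
    have hxyA : ((x, y) ∈ A ∨ (y, x) ∈ A) ∧ x ∈ U ∧ y ∈ U := by
      rcases (hG _ _).mp hxy with h | h
      · exact ⟨.inl (hT _ _ h).1, (hT _ _ h).2⟩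
      · exact ⟨.inr (hT _ _ h).1, (hT _ _ h).2.2, (hT _ _ h).2.1⟩
    refine ⟨x, hxyA.2.1, y, hxyA.2.2, (hRadj x y).mpr hxyA.1, ?_⟩
    intro z hz hxz hzy
    rw [hRadj] at hxz ⊢
    rcases hxz with h | h
    · obtain ⟨h1, h2⟩ := hout z hz h
      rcases reflTransGen_iff_eq_or_transGen.mp h2 with h3 | h3
      · exact absurd h3 hzy
      · exact .inl (filled_arc ⟨hirr, hasym, hac⟩ hF h (.single h1) h3).2
    · obtain ⟨h1, h2⟩ := hin z hz h
      rcases reflTransGen_iff_eq_or_transGen.mp h2 with h3 | h3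
      · exact absurd h3.symm hzy
      · exact .inr (filled_arc ⟨hirr, hasym, hac⟩ hF h h3 (.single h1)).1

def Desc {V : Type*} (A B : Set (V × V)) (a : V × V) : Prop := a ∈ B ∧ ARmem A (B \ {a})

theorem desc_transRed {V : Type*} {A B : Set (V × V)} (hB : ARmem A B) {u v : V}
    (h : Desc A B (u, v)) : (v, u) ∈ transRed (reorient A B) := by
  refine ⟨mem_reorient.mpr (.inr h.1), ?_⟩
  rintro ⟨w, hvw, hwu⟩
  have hwu' : TransGen (ArcRel (reorient A B)) w u := hwu
  have hvw' : ArcRel (reorient A B) v w := hvw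
  have hstep : ∀ x y, ArcRel (reorient A B) x y → (x, y) ≠ (v, u) →
      ArcRel (reorient A (B \ {(u, v)})) x y := by
    intro x y hxy hne
    rcases mem_reorient.mp hxy with h1 | h1
    · exact mem_reorient.mpr (.inl ⟨h1.1, fun h2 => h1.2 h2.1⟩)
    · refine mem_reorient.mpr (.inr ⟨h1, ?_⟩)
      intro h2
      simp only [Set.mem_singleton_iff, Prod.mk.injEq] at h2
      exact hne (by rw [h2.1, h2.2])
  have hpath : ∀ x, TransGen (ArcRel (reorient A B)) v x →
      TransGen (ArcRel (reorient A B)) x u → TransGen (ArcRel (reorient A (B \ {(u, v)}))) x u := by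
    intro x hx hxu
    induction hxu using TransGen.head_induction_on with
    | single h1 =>
      refine .single (hstep _ _ h1 ?_)
      intro h2
      simp only [Prod.mk.injEq] at h2
      exact hB.2 v (by simpa [h2.1] using hx)
    | head h1 h2 ih =>
      refine .head (hstep _ _ h1 ?_) (ih (hx.tail h1))
      intro h2
      simp only [Prod.mk.injEq] at h2
      exact hB.2 v (by simpa [h2.1] using hx)
  have h1 : TransGen (ArcRel (reorient A (B \ {(u, v)}))) w u :=
    hpath w (.single hvw') hwu'
  have h2 : ArcRel (reorient A (B \ {(u, v)})) v w := by
    refine hstep _ _ hvw' ?_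
    intro h2
    simp only [Prod.mk.injEq] at h2
    exact hB.2 u (by simpa [h2.2] using hwu')
  have h3 : ArcRel (reorient A (B \ {(u, v)})) u v :=
    mem_reorient.mpr (.inl ⟨hB.1 h.1, fun h => h.2 rfl⟩)
  exact h.2.2 u (.head h3 (.head h2 h1))

theorem transRed_desc {V : Type*} [Finite V] {A B : Set (V × V)} (hA : IsDAG A)
    (hS : Skeletal A) (hB : ARmem A B) {u v : V} (huv : (u, v) ∈ B)
    (h : (v, u) ∈ transRed (reorient A B)) : Desc A B (u, v) := by
  refine ⟨huv, mem_of_biclosed hA hS ?_⟩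
  have hb := biclosed_of_mem hB
  refine ⟨fun x hx => hb.1 hx.1, ?_⟩
  have hno : ∀ w, (v, w) ∈ reorient A B → (w, u) ∈ reorient A B → False :=
    fun w h1 h2 => h.2 ⟨w, h1, .single h2⟩
  intro x y z hxy hyz hxz
  have h1 := hb.2 x y z hxy hyz hxz
  have hn := hno y
  simp only [mem_reorient] at hn
  have i1 : ∀ x y, (x, y) ∈ A → x ≠ y := fun x y h => hA.1 _ h
  have hno' : ∀ w, (w, u) ∈ reorient A B → (v, w) ∈ reorient A B → False :=
    fun w h1 h2 => hno w h2 h1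
  simp only [mem_reorient] at hno'
  simp only [Set.mem_sdiff, Set.mem_singleton_iff, Prod.mk.injEq]
  have i2 : ∀ x y, (x, y) ∈ A → (y, x) ∉ A := fun x y h => hA.2.1 _ h
  have n1 := hno' x
  have n2 := hno' y
  have n3 := hno' z
  have := i1 x y hxy
  have := i1 y z hyz
  have := i1 x z hxz
  grind

theorem exists_desc {V : Type*} [Finite V] {A B C : Set (V × V)} (hA : IsDAG A)
    (hS : Skeletal A) (hB : ARmem A B) (hC : ARmem A C) (hCB : C ⊆ B) (hne : C ≠ B) :
    ∃ a ∈ B, a ∉ C ∧ Desc A B a := by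
  by_contra hcon
  push Not at hcon
  have hsub : ∀ x y, ArcRel (transRed (reorient A B)) x y → ArcRel (reorient A C) x y := by
    intro x y hxy
    rcases mem_reorient.mp hxy.1 with h1 | h1
    · exact mem_reorient.mpr (.inl ⟨h1.1, fun h => h1.2 (hCB h)⟩)
    · refine mem_reorient.mpr (.inr ?_)
      by_contra h2
      exact hcon _ h1 h2 (transRed_desc hA hS hB h1 hxy)
  obtain ⟨⟨u, v⟩, hB', hC'⟩ := Set.exists_of_ssubset (hCB.ssubset_of_ne hne)
  have h1 : ArcRel (reorient A B) v u := mem_reorient.mpr (.inr hB')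
  have h2 := tg_mono (transRed_gen hB.2 _ v u le_rfl (.single h1)) hsub
  have h3 : ArcRel (reorient A C) u v := mem_reorient.mpr (.inl ⟨hB.1 hB', hC'⟩)
  exact hC.2 u (.head h3 h2)

theorem desc_cover {V : Type*} {A B : Set (V × V)} {a : V × V} (h : Desc A B a) :
    ARmem A (B \ {a}) ∧ B \ {a} ⊆ B ∧ B \ {a} ≠ B ∧
    ∀ E, ARmem A E → B \ {a} ⊆ E → E ⊆ B → E = B \ {a} ∨ E = B := by
  refine ⟨h.2, Set.sdiff_subset, ?_, ?_⟩
  · intro h2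
    have : a ∈ B \ {a} := by rw [h2]; exact h.1
    exact this.2 rfl
  · intro E _ h1 h2
    by_cases ha : a ∈ E
    · right
      apply h2.antisymm
      intro x hx
      by_cases hxa : x = a
      · exact hxa ▸ ha
      · exact h1 ⟨hx, hxa⟩
    · left
      exact Set.Subset.antisymm (fun x hx => ⟨h2 hx, fun hxa => ha (hxa ▸ hx)⟩) h1

theorem joinIrr_iff {V : Type*} [Finite V] {A B : Set (V × V)} (hA : IsDAG A)
    (hS : Skeletal A) : JoinIrrAR A B ↔ ARmem A B ∧ ∃! a, Desc A B a := by
  constructor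
  · rintro ⟨hB, C, hC, hu⟩
    refine ⟨hB, ?_⟩
    obtain ⟨a, -, -, ha⟩ := exists_desc hA hS hB hC.1 hC.2.1 hC.2.2.1
    refine ⟨a, ha, fun b hb => ?_⟩
    have h1 := hu _ (desc_cover ha)
    have h2 := hu _ (desc_cover hb)
    by_contra hne
    have : b ∈ B \ {a} := ⟨hb.1, hne⟩
    rw [h1, ← h2] at this
    exact this.2 rfl
  · rintro ⟨hB, a, ha, hu⟩
    refine ⟨hB, B \ {a}, desc_cover ha, fun C hC => ?_⟩
    obtain ⟨b, hb, hbC, hd⟩ := exists_desc hA hS hB hC.1 hC.2.1 hC.2.2.1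
    have := hu b hd
    subst this
    have hd' := desc_cover hd
    rcases hC.2.2.2 _ hd'.1 (fun x hx => ⟨hC.2.1 hx, fun hxa => hbC (hxa ▸ hx)⟩) hd'.2.1 with h | h
    · exact h.symm
    · exact absurd h hd'.2.2.1

theorem rope_facts {V : Type*} {A : Set (V × V)} (hA : IsDAG A) (hS : Skeletal A)
    {u v : V} (huv : (u, v) ∈ A) {w : V} (hw : w ∈ transSupport A u v \ {u, v}) :
    (u, w) ∈ A ∧ (w, v) ∈ A := by
  obtain ⟨⟨h1, h2⟩, h3⟩ := hw
  simp only [Set.mem_insert_iff, Set.mem_singleton_iff, not_or] at h3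
  rcases reflTransGen_iff_eq_or_transGen.mp h1 with h | h1
  · exact absurd h h3.1
  rcases reflTransGen_iff_eq_or_transGen.mp h2 with h | h2
  · exact absurd h.symm h3.2
  exact filled_arc hA hS.2 huv h1 h2

/-- Elementary description of the vertices of a rope. -/
theorem rope_sets {V : Type*} {A : Set (V × V)} (hA : IsDAG A) (hS : Skeletal A)
    {r : RopeData V} (hr : IsRope A r) :
    (∀ w, w ∈ r.down → (r.u, w) ∈ A ∧ (w, r.v) ∈ A ∧ w ∉ r.up) ∧
    (∀ w, w ∈ r.up → (r.u, w) ∈ A ∧ (w, r.v) ∈ A ∧ w ∉ r.down) ∧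
    (∀ w, (r.u, w) ∈ A → (w, r.v) ∈ A → w ∈ r.down ∨ w ∈ r.up) := by
  obtain ⟨huv, hdis, hun⟩ := hr
  have hd : ∀ w, w ∈ r.down → w ∉ r.up := fun w h1 h2 => by
    have : w ∈ r.down ∩ r.up := ⟨h1, h2⟩
    rw [hdis] at this
    exact this
  refine ⟨fun w hw => ?_, fun w hw => ?_, fun w h1 h2 => ?_⟩
  · have := rope_facts hA hS huv (hun ▸ Or.inl hw : w ∈ transSupport A r.u r.v \ {r.u, r.v})
    exact ⟨this.1, this.2, hd w hw⟩
  · have := rope_facts hA hS huv (hun ▸ Or.inr hw : w ∈ transSupport A r.u r.v \ {r.u, r.v})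
    exact ⟨this.1, this.2, fun h => hd w h hw⟩
  · have : w ∈ r.down ∪ r.up := by
      rw [hun]
      refine ⟨⟨.single h1, .single h2⟩, ?_⟩
      simp only [Set.mem_insert_iff, Set.mem_singleton_iff, not_or]
      exact ⟨(hA.1 _ h1).symm, hA.1 _ h2⟩
    exact this

theorem mem_Ijoin {V : Type*} {A : Set (V × V)} {r : RopeData V} {x y : V} :
    (x, y) ∈ Ijoin A r ↔ (x, y) ∈ A ∧ (x ∈ r.up ∨ x = r.u) ∧ (y ∈ r.down ∨ y = r.v) := by
  simp [Ijoin, or_comm]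
  try tauto

theorem Ijoin_biclosed {V : Type*} {A : Set (V × V)} (hA : IsDAG A) (hS : Skeletal A)
    {r : RopeData V} (hr : IsRope A r) :
    Biclosed A (Ijoin A r) ∧ Biclosed A (Ijoin A r \ {(r.u, r.v)}) := by
  obtain ⟨k1, k2, k3⟩ := rope_sets hA hS hr
  have huv := hr.1
  have hac := hA.2.2
  have i1 : ∀ x y, (x, y) ∈ A → x ≠ y := fun x y h => hA.1 _ h
  have i2 : ∀ x y, (x, y) ∈ A → (y, x) ∉ A := fun x y h => hA.2.1 _ h
  have hcl : ∀ x y z, (x, y) ∈ Ijoin A r → (y, z) ∈ Ijoin A r → False := by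
    intro x y z h1 h2
    rw [mem_Ijoin] at h1 h2
    rcases h1.2.2 with h | h <;> rcases h2.2.1 with h' | h'
    · exact (k1 _ h).2.2 h'
    · exact i1 _ _ (k1 _ h).1 h'.symm
    · exact i1 _ _ (k2 _ h').2.1 h
    · exact i1 _ _ huv (h'.symm.trans h)
  have hco : ∀ x y z, (x, y) ∈ A → (y, z) ∈ A → (x, z) ∈ A → (x, z) ∈ Ijoin A r →
      (y ∈ r.down ∧ (x, y) ∈ Ijoin A r) ∨ (y ∈ r.up ∧ (y, z) ∈ Ijoin A r) := by
    intro x y z hxy hyz hxz h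
    simp only [mem_Ijoin] at h ⊢
    have hux : ReflTransGen (ArcRel A) r.u x := by
      rcases h.2.1 with h | h
      · exact .single (k2 _ h).1
      · rw [h]
    have hzv : ReflTransGen (ArcRel A) z r.v := by
      rcases h.2.2 with h | h
      · exact .single (k1 _ h).2.1
      · rw [h]
    have huy : TransGen (ArcRel A) r.u y := TransGen.tail' hux hxy
    have hyv : TransGen (ArcRel A) y r.v := TransGen.head' hyz hzv
    obtain ⟨e1, e2⟩ := filled_arc hA hS.2 huv huy hyv
    rcases k3 y e1 e2 with hy | hy
    · exact .inl ⟨hy, hxy, h.2.1, .inl hy⟩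
    · exact .inr ⟨hy, hyz, .inl hy, h.2.2⟩
  refine ⟨⟨fun a h => h.1, fun x y z hxy hyz hxz => ⟨fun h1 h2 => (hcl _ _ _ h1 h2).elim, ?_⟩⟩,
    ⟨fun a h => h.1.1, fun x y z hxy hyz hxz => ⟨fun h1 h2 => (hcl _ _ _ h1.1 h2.1).elim, ?_⟩⟩⟩
  · intro h
    rcases hco x y z hxy hyz hxz h with h | h
    · exact .inl h.2
    · exact .inr h.2
  · rintro ⟨h, -⟩
    rcases hco x y z hxy hyz hxz h with h | h
    · refine .inl ⟨h.2, fun h' => ?_⟩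
      simp only [Set.mem_singleton_iff, Prod.mk.injEq] at h'
      exact i1 _ _ (k1 _ h.1).2.1 h'.2
    · refine .inr ⟨h.2, fun h' => ?_⟩
      simp only [Set.mem_singleton_iff, Prod.mk.injEq] at h'
      exact i1 _ _ (k2 _ h.1).1 h'.1.symm

theorem Ijoin_desc {V : Type*} [Finite V] {A : Set (V × V)} (hA : IsDAG A) (hS : Skeletal A)
    {r : RopeData V} (hr : IsRope A r) :
    ARmem A (Ijoin A r) ∧ Desc A (Ijoin A r) (r.u, r.v) ∧
      ∀ a, Desc A (Ijoin A r) a → a = (r.u, r.v) := by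
  obtain ⟨k1, k2, k3⟩ := rope_sets hA hS hr
  have huv := hr.1
  have i1 : ∀ x y, (x, y) ∈ A → x ≠ y := fun x y h => hA.1 _ h
  obtain ⟨b1, b2⟩ := Ijoin_biclosed hA hS hr
  refine ⟨mem_of_biclosed hA hS b1, ⟨mem_Ijoin.mpr ⟨huv, .inr rfl, .inr rfl⟩,
    mem_of_biclosed hA hS b2⟩, ?_⟩
  rintro ⟨a, c⟩ ⟨hac, hd⟩
  have hd := (biclosed_of_mem hd).2
  have hac' := mem_Ijoin.mp hac
  have hau : a = r.u := by
    by_contra hne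
    have ha : a ∈ r.up := hac'.2.1.resolve_right hne
    have huc : (r.u, c) ∈ A := by
      rcases hac'.2.2 with h | h
      · exact (k1 _ h).1
      · rw [h]; exact huv
    have := (hd r.u a c (k2 _ ha).1 hac'.1 huc).2
      ⟨mem_Ijoin.mpr ⟨huc, .inr rfl, hac'.2.2⟩, by simp [Ne.symm hne]⟩
    rcases this with h | h
    · rcases (mem_Ijoin.mp h.1).2.2 with h | h
      · exact (k1 _ h).2.2 ha
      · exact i1 _ _ (k2 _ ha).2.1 h
    · exact h.2 rfl
  have hcv : c = r.v := by
    by_contra hne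
    have hc : c ∈ r.down := hac'.2.2.resolve_right hne
    have hav : (a, r.v) ∈ A := by rw [hau]; exact huv
    have := (hd a c r.v hac'.1 (k1 _ hc).2.1 hav).2
      ⟨mem_Ijoin.mpr ⟨hav, hac'.2.1, .inr rfl⟩, by simp [Ne.symm hne]⟩
    rcases this with h | h
    · exact h.2 rfl
    · rcases (mem_Ijoin.mp h.1).2.1 with h | h
      · exact (k1 _ hc).2.2 h
      · exact i1 _ _ (k1 _ hc).1 h.symm
  rw [hau, hcv]

theorem rope_of_desc {V : Type*} [Finite V] {A B : Set (V × V)} (hA : IsDAG A) (hS : Skeletal A)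
    (hB : ARmem A B) {u v : V} (hd : Desc A B (u, v)) (huniq : ∀ a, Desc A B a → a = (u, v)) :
    IsRope A ⟨u, v, deltaDown A B u v, deltaUp A B u v⟩ ∧
      Ijoin A ⟨u, v, deltaDown A B u v, deltaUp A B u v⟩ = B := by
  have hb := biclosed_of_mem hB
  have hb' := biclosed_of_mem hd.2
  have huvB := hd.1
  have huvA := hB.1 huvB
  have i1 : ∀ x y, (x, y) ∈ A → x ≠ y := fun x y h => hA.1 _ h
  have hrope : IsRope A ⟨u, v, deltaDown A B u v, deltaUp A B u v⟩ := by
    refine ⟨huvA, ?_, ?_⟩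
    · ext w
      simp only [deltaDown, deltaUp, Set.mem_inter_iff, Set.mem_ofPred_eq, Set.mem_empty_iff_false,
        Set.mem_sdiff]
      tauto
    · ext w
      constructor
      · intro hw
        have h12 : (u, w) ∈ A ∧ (w, v) ∈ A := by
          rcases hw with hw | hw
          · exact ⟨hB.1 hw.1, hw.2.1⟩
          · exact ⟨hw.1.1, hB.1 hw.2⟩
        refine ⟨⟨.single h12.1, .single h12.2⟩, ?_⟩
        simp only [Set.mem_insert_iff, Set.mem_singleton_iff, not_or]
        exact ⟨(i1 _ _ h12.1).symm, i1 _ _ h12.2⟩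
      · intro hw
        obtain ⟨h1, h2⟩ := rope_facts hA hS huvA hw
        have c1 := (hb.2 u w v h1 h2 huvA).2 huvB
        have c2 := (hb'.2 u w v h1 h2 huvA).1
        have c3 : ¬ ((u, w) ∈ B ∧ (w, v) ∈ B) := by
          rintro ⟨e1, e2⟩
          refine (c2 ⟨e1, ?_⟩ ⟨e2, ?_⟩).2 rfl
          · simp [i1 _ _ h2]
          · simp [(i1 _ _ h1).symm]
        simp only [deltaDown, deltaUp, Set.mem_union, Set.mem_ofPred_eq, Set.mem_sdiff]
        tauto
  refine ⟨hrope, ?_⟩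
  obtain ⟨m, -, -⟩ := Ijoin_desc hA hS hrope
  by_contra hne
  have hsub : Ijoin A ⟨u, v, deltaDown A B u v, deltaUp A B u v⟩ ⊆ B := by
    rintro ⟨w, w'⟩ h
    obtain ⟨h0, h1, h2⟩ := mem_Ijoin.mp h
    simp only at h1 h2
    rcases h1 with h1 | rfl
    · rcases h2 with h2 | rfl
      · exact ((hb.2 u w w' h1.1.1 h0 (hB.1 h2.1)).2 h2.1).resolve_left h1.1.2
      · exact h1.2
    · rcases h2 with h2 | rfl
      · exact h2.1
      · exact huvB
  obtain ⟨a, -, haI, had⟩ := exists_desc hA hS hB m hsub hne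
  rw [huniq a had] at haI
  exact haI (mem_Ijoin.mpr ⟨huvA, .inr rfl, .inr rfl⟩)

/-- The map `I_∨` is a bijection from the ropes of `D` onto the
join irreducible elements of `AR(D)`, with the stated inverse. -/
theorem stmt_16 {V : Type*} [Fintype V] (A : Set (V × V)) (hA : IsDAG A)
    (hS : Skeletal A) :
    (∀ r : RopeData V, IsRope A r → JoinIrrAR A (Ijoin A r)) ∧
    (∀ r r' : RopeData V, IsRope A r → IsRope A r' → Ijoin A r = Ijoin A r' → r = r') ∧
    (∀ B, JoinIrrAR A B → ∃ r : RopeData V, IsRope A r ∧ Ijoin A r = B) ∧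
    (∀ B, JoinIrrAR A B → ∀ u v : V, (u, v) ∈ B →
      (v, u) ∈ transRed (reorient A B) →
      IsRope A ⟨u, v, deltaDown A B u v, deltaUp A B u v⟩ ∧
      Ijoin A ⟨u, v, deltaDown A B u v, deltaUp A B u v⟩ = B) := by
  refine ⟨fun r hr => ?_, fun r r' hr hr' heq => ?_, fun B hB => ?_, fun B hB u v huv ht => ?_⟩
  · obtain ⟨h1, h2, h3⟩ := Ijoin_desc hA hS hr
    exact (joinIrr_iff hA hS).mpr ⟨h1, _, h2, h3⟩
  · obtain ⟨h1, h2, h3⟩ := Ijoin_desc hA hS hr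
    obtain ⟨h1', h2', h3'⟩ := Ijoin_desc hA hS hr'
    have huv := h3' _ (heq ▸ h2)
    obtain ⟨k1, k2, -⟩ := rope_sets hA hS hr
    obtain ⟨k1', k2', -⟩ := rope_sets hA hS hr'
    have i1 : ∀ x y, (x, y) ∈ A → x ≠ y := fun x y h => hA.1 _ h
    have hmem : ∀ x y, (x, y) ∈ Ijoin A r ↔ (x, y) ∈ Ijoin A r' := fun x y => by rw [heq]
    simp only [mem_Ijoin] at hmem
    obtain ⟨u, v, d, p⟩ := r
    obtain ⟨u', v', d', p'⟩ := r'
    simp only [Prod.mk.injEq] at huv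
    obtain ⟨rfl, rfl⟩ := huv
    simp only at hmem k1 k2 k1' k2'
    have hd : d = d' := by
      ext w
      constructor
      · intro h
        exact ((hmem u w).mp ⟨(k1 _ h).1, .inr rfl, .inl h⟩).2.2.resolve_right
          (i1 _ _ (k1 _ h).2.1)
      · intro h
        exact ((hmem u w).mpr ⟨(k1' _ h).1, .inr rfl, .inl h⟩).2.2.resolve_right
          (i1 _ _ (k1' _ h).2.1)
    have hp : p = p' := by
      ext w
      constructor
      · intro h
        exact ((hmem w v).mp ⟨(k2 _ h).2.1, .inl h, .inr rfl⟩).2.1.resolve_right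
          (i1 _ _ (k2 _ h).1).symm
      · intro h
        exact ((hmem w v).mpr ⟨(k2' _ h).2.1, .inl h, .inr rfl⟩).2.1.resolve_right
          (i1 _ _ (k2' _ h).1).symm
    rw [hd, hp]
  · obtain ⟨h1, ⟨u, v⟩, h2, h3⟩ := (joinIrr_iff hA hS).mp hB
    exact ⟨_, rope_of_desc hA hS h1 h2 h3⟩
  · obtain ⟨h1, a, h2, h3⟩ := (joinIrr_iff hA hS).mp hB
    have hd := transRed_desc hA hS h1 huv ht
    refine rope_of_desc hA hS h1 hd fun b hb => ?_
    rw [h3 b hb, h3 _ hd]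
end

section
/- Let D = (V, A) be a skeletal directed acyclic graph. For B ∈ AR(D), let δ_∨(B) be the set of ropes (u, v, Δ^B_{u,v}, ∇^B_{u,v}) over all arcs (u,v) ∈ B whose reversed arc (v,u) belongs to the transitive reduction of E_B. Then δ_∨ is a bijection from AR(D) onto the set of non-crossing rope diagrams of D. -/
/-- Two ropes are crossing. -/
def Crossing {V : Type*} (r r' : RopeData V) : Prop :=
  ∃ w w' : V, w ≠ w' ∧
    w ∈ (r.down ∪ {r.u, r.v}) ∩ (r'.up ∪ {r'.u, r'.v}) ∧
    w' ∈ (r.up ∪ {r.u, r.v}) ∩ (r'.down ∪ {r'.u, r'.v})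

/-- A non-crossing rope diagram: a set of pairwise non-crossing ropes of `A`. -/
def IsNCDiagram {V : Type*} (A : Set (V × V)) (δ : Set (RopeData V)) : Prop :=
  (∀ r ∈ δ, IsRope A r) ∧ δ.Pairwise fun r r' => ¬ Crossing r r'

/-- The rope diagram `δ_∨(B)` of an acyclic reorientation `B`. -/
def joinDiagram {V : Type*} (A B : Set (V × V)) : Set (RopeData V) :=
  {r | (r.u, r.v) ∈ B ∧ (r.v, r.u) ∈ transRed (reorient A B) ∧
    r.down = deltaDown A B r.u r.v ∧ r.up = deltaUp A B r.u r.v}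


theorem aux_path_of_transGen {V : Type*} {R : V → V → Prop} {a b : V}
    (h : Relation.TransGen R a b) :
    ∃ (n : ℕ) (p : ℕ → V), 1 ≤ n ∧ p 0 = a ∧ p n = b ∧ ∀ i < n, R (p i) (p (i+1)) := by
  induction h with
  | @single b h =>
    refine ⟨1, fun i => if i = 0 then a else b, le_refl _, by simp, by simp, ?_⟩
    intro i hi
    have : i = 0 := by omega
    subst this
    simpa using h
  | @tail b c _ h ih =>
    obtain ⟨n, p, hn, h0, h1, h2⟩ := ih
    refine ⟨n+1, fun i => if i ≤ n then p i else c, by omega, by simp [h0], by simp, ?_⟩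
    intro i hi
    rcases Nat.lt_or_ge i n with h' | h'
    · have h3 : i + 1 ≤ n := h'
      have h4 : i ≤ n := by omega
      simp only [h3, h4, if_true]
      exact h2 i h'
    · have : i = n := by omega
      subst this
      simpa [h1] using h

theorem aux_list_of_transGen {V : Type*} {R : V → V → Prop} {a b : V}
    (h : Relation.TransGen R a b) :
    ∃ l : List V, List.IsChain R (a :: l) ∧ (a :: l).getLast? = some b := by
  induction h using Relation.TransGen.head_induction_on with
  | single h => exact ⟨[b], by simpa using h, by simp⟩
  | @head a c h _ ih =>
    obtain ⟨l, hl, hl'⟩ := ih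
    exact ⟨c :: l, by simp [hl, h], by simpa using hl'⟩

def aAdj {V : Type*} (A : Set (V × V)) (x y : V) : Prop := (x, y) ∈ A ∨ (y, x) ∈ A

theorem aux_asymm {V : Type*} {A : Set (V × V)} (hA : IsDAG A) {x y : V}
    (h : (x, y) ∈ A) (h' : (y, x) ∈ A) : False := hA.2.1 _ h h'

theorem aux_irr {V : Type*} {A : Set (V × V)} (hA : IsDAG A) {x : V}
    (h : (x, x) ∈ A) : False := hA.1 _ h rfl

theorem aux_fill {V : Type*} {A : Set (V × V)} (hA : IsDAG A) (hF : Filled A) {u w v : V}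
    (h1 : Relation.TransGen (ArcRel A) u w) (h2 : Relation.TransGen (ArcRel A) w v)
    (h : (u, v) ∈ A) : (u, w) ∈ A ∧ (w, v) ∈ A := by
  have key : ∀ x, (x = u ∨ x = v) → x ≠ w → (x, w) ∈ A ∨ (w, x) ∈ A := by
    intro x hx hxw
    obtain ⟨l1, c1, e1⟩ := aux_list_of_transGen h1
    obtain ⟨c, hc, h3⟩ := (Relation.TransGen.head'_iff).1 h2
    rcases Relation.reflTransGen_iff_eq_or_transGen.1 h3 with h3 | h3
    · subst h3
      have hm : w ∈ (u :: l1) := List.mem_of_getLast? e1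
      refine hF ((u :: l1) ++ [v]) ?_ u v (by simp) (by rw [List.getLast?_append]; rfl) h x ?_ w (by simp at hm ⊢; tauto) hxw
      · refine List.IsChain.append c1 (by simp) ?_
        intro y hy z hz
        rw [e1] at hy
        simp at hy hz
        subst hy; subst hz; exact hc
      · simp; tauto
    · obtain ⟨l2, c2, e2⟩ := aux_list_of_transGen h3
      have hm : w ∈ (u :: l1) := List.mem_of_getLast? e1
      have hm' : v ∈ (c :: l2) := List.mem_of_getLast? e2
      refine hF ((u :: l1) ++ (c :: l2)) ?_ u v (by simp) ?_ h x ?_ w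
        (by rw [List.mem_append]; exact Or.inl hm) hxw
      · refine List.IsChain.append c1 c2 ?_
        intro y hy z hz
        rw [e1] at hy
        simp at hy hz
        subst hy; subst hz; exact hc
      · rw [List.getLast?_append, e2]; rfl
      · rcases hx with rfl | rfl
        · simp
        · rw [List.mem_append]; exact Or.inr hm'
  have huw : u ≠ w := by rintro rfl; exact hA.2.2 _ h1
  have hvw : v ≠ w := by rintro rfl; exact hA.2.2 _ h2
  constructor
  · rcases key u (Or.inl rfl) huw with h' | h'
    · exact h'
    · exact (hA.2.2 _ (h1.tail h')).elim
  · rcases key v (Or.inr rfl) hvw with h' | h'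
    · exact (hA.2.2 _ (h2.tail h')).elim
    · exact h'

theorem aux_red {V : Type*} {A : Set (V × V)} (hA : IsDAG A) (hF : Filled A) {U : Set V}
    {a b : V} (ha : a ∈ U) (hb : b ∈ U) (h : aAdj A a b)
    (hn : ∀ c ∈ U, aAdj A a c → aAdj A c b → False) :
    (undirectedGraph (transRed (inducedArcs A U))).Adj a b := by
  have main : ∀ a b, a ∈ U → b ∈ U → (a, b) ∈ A →
      (∀ c ∈ U, aAdj A a c → aAdj A c b → False) → (a, b) ∈ transRed (inducedArcs A U) := by
    intro a b ha hb h hn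
    refine ⟨⟨h, ha, hb⟩, ?_⟩
    rintro ⟨w, hw, hw'⟩
    have := aux_fill hA hF (Relation.TransGen.single (show ArcRel A a w from hw.1))
      (hw'.lift id (fun _ _ h => h.1)) h
    exact hn w hw.2.2 (Or.inl this.1) (Or.inl this.2)
  unfold undirectedGraph
  rw [SimpleGraph.fromRel_adj]
  rcases h with h | h
  · exact ⟨fun e => aux_irr hA (e ▸ h), Or.inl (main a b ha hb h hn)⟩
  · exact ⟨fun e => aux_irr hA (e ▸ h), Or.inr (main b a hb ha h
      fun c hc h1 h2 => hn c hc h2.symm h1.symm)⟩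

theorem aux_bridge {V : Type*} {G : SimpleGraph V} (hG : G.IsAcyclic) (n : ℕ) (p : ℕ → V)
    (h : ∀ i < n, G.Adj (p i) (p (i+1))) (h0 : G.Adj (p 0) (p n))
    (hne : ∀ i < n, s(p i, p (i+1)) ≠ s(p 0, p n)) : False := by
  have hb := SimpleGraph.isAcyclic_iff_forall_adj_isBridge.1 hG h0
  rw [SimpleGraph.isBridge_iff] at hb
  apply hb
  have : ∀ i ≤ n, (G.deleteEdges {s(p 0, p n)}).Reachable (p 0) (p i) := by
    intro i
    induction i with
    | zero => intro _; exact SimpleGraph.Reachable.refl _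
    | succ i ih =>
      intro hi
      refine (ih (by omega)).trans (SimpleGraph.Adj.reachable ?_)
      rw [SimpleGraph.deleteEdges_adj]
      exact ⟨h i hi, hne i hi⟩
  exact this n le_rfl

theorem aux_chordless {V : Type*} {A : Set (V × V)} (hA : IsDAG A) (hS : Skeletal A)
    (n : ℕ) (hn : 3 ≤ n) (p : ℕ → V) (h : ∀ i < n, aAdj A (p i) (p (i+1)))
    (h0 : aAdj A (p 0) (p n))
    (hc : ∀ i j, i + 2 ≤ j → j ≤ n → ¬ (i = 0 ∧ j = n) → p i ≠ p j ∧ ¬ aAdj A (p i) (p j)) :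
    False := by
  have hsym : ∀ x y, aAdj A x y → aAdj A y x := fun x y h => Or.symm h
  have hirr : ∀ x, ¬ aAdj A x x := fun x h => h.elim (aux_irr hA) (aux_irr hA)
  have hadj : ∀ i j, i ≤ n → j ≤ n → aAdj A (p i) (p j) →
      j = i + 1 ∨ i = j + 1 ∨ (i = 0 ∧ j = n) ∨ (j = 0 ∧ i = n) := by
    intro i j hi hj hij
    by_contra hcon
    push Not at hcon
    obtain ⟨c1, c2, c3, c4⟩ := hcon
    rcases lt_trichotomy i j with h' | h' | h'
    · exact (hc i j (by omega) hj (by tauto)).2 hij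
    · subst h'; exact hirr _ hij
    · exact (hc j i (by omega) hi (by tauto)).2 (hsym _ _ hij)
  have hinj : ∀ i j, i ≤ n → j ≤ n → p i = p j → i = j := by
    intro i j hi hj hij
    by_contra hne
    by_cases hcons : j = i + 1 ∨ i = j + 1 ∨ (i = 0 ∧ j = n) ∨ (j = 0 ∧ i = n)
    · rcases hcons with h1 | h1 | h1 | h1
      · have := h i (by omega); rw [← h1, hij] at this; exact hirr _ this
      · have := h j (by omega); rw [← h1, hij] at this; exact hirr _ this
      · rw [← h1.1, ← h1.2, hij] at h0; exact hirr _ h0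
      · rw [← h1.1, ← h1.2, hij] at h0; exact hirr _ h0
    · push Not at hcons
      obtain ⟨c1, c2, c3, c4⟩ := hcons
      rcases lt_trichotomy i j with h' | h' | h'
      · exact (hc i j (by omega) hj (by tauto)).1 hij
      · exact hne h'
      · exact (hc j i (by omega) hi (by tauto)).1 hij.symm
  have htri : ∀ i j, i ≤ n → j ≤ n → aAdj A (p i) (p j) → 
      ∀ c ∈ {x | ∃ i ≤ n, p i = x}, aAdj A (p i) c → aAdj A c (p j) → False := by
    rintro i j hi hj hij c ⟨k, hk, rfl⟩ h1 h2
    have e1 := hadj i j hi hj hij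
    have e2 := hadj i k hi hk h1
    have e3 := hadj k j hk hj h2
    omega
  refine aux_bridge (hS.1 {x | ∃ i ≤ n, p i = x}) n p ?_ ?_ ?_
  · intro i hi
    exact aux_red hA hS.2 ⟨i, by omega, rfl⟩ ⟨i+1, by omega, rfl⟩ (h i hi)
      (htri _ _ (by omega) (by omega) (h i hi))
  · exact aux_red hA hS.2 ⟨0, by omega, rfl⟩ ⟨n, by omega, rfl⟩ h0
      (htri _ _ (by omega) (by omega) h0)
  · intro i hi he
    rw [Sym2.eq_iff] at he
    rcases he with ⟨a, b⟩ | ⟨a, b⟩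
    · have := hinj _ _ (by omega) (by omega) a
      have := hinj _ _ (by omega) (by omega) b
      omega
    · have := hinj _ _ (by omega) (by omega) a
      omega

theorem aux_tour {V : Type*} {A : Set (V × V)} (hA : IsDAG A) (hS : Skeletal A) {u v w w' : V}
    (h1 : (u, w) ∈ A) (h2 : (w, v) ∈ A) (h3 : (u, w') ∈ A) (h4 : (w', v) ∈ A)
    (hne : w ≠ w') : (w, w') ∈ A ∨ (w', w) ∈ A := by
  by_contra hcon
  have hi : ∀ {x}, (x, x) ∉ A := fun h => aux_irr hA h
  have has : ∀ {x y}, (x, y) ∈ A → (y, x) ∉ A := fun h h' => aux_asymm hA h h'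
  push Not at hcon
  have huv : u ≠ v := by rintro rfl; exact has h1 h2
  have mk : ∀ a b, a ∈ ({u, w, w', v} : Set V) → b ∈ ({u, w, w', v} : Set V) → (a, b) ∈ A →
      (∀ c ∈ ({u, w, w', v} : Set V), (a, c) ∈ A → (c, b) ∈ A → False) →
      (undirectedGraph (transRed (inducedArcs A {u, w, w', v}))).Adj a b := by
    intro a b ha hb hab hh
    unfold undirectedGraph
    rw [SimpleGraph.fromRel_adj]
    refine ⟨fun e => hi (e ▸ hab), Or.inl ⟨⟨hab, ha, hb⟩, ?_⟩⟩
    rintro ⟨c, hc, hc'⟩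
    have := aux_fill hA hS.2 (Relation.TransGen.single (show ArcRel A a c from hc.1))
      (hc'.lift id (fun _ _ h => h.1)) hab
    exact hh c hc.2.2 this.1 this.2
  have e1 := mk u w (by simp) (by simp) h1 (by
    rintro c (rfl | rfl | rfl | rfl) <;> intro a b
    · exact hi a
    · exact hi b
    · exact hcon.2 b
    · exact has b h2)
  have e2 := mk w v (by simp) (by simp) h2 (by
    rintro c (rfl | rfl | rfl | rfl) <;> intro a b
    · exact has a h1
    · exact hi a
    · exact hcon.1 a
    · exact hi b)
  have e3 := mk u w' (by simp) (by simp) h3 (by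
    rintro c (rfl | rfl | rfl | rfl) <;> intro a b
    · exact hi a
    · exact hcon.1 b
    · exact hi b
    · exact has b h4)
  have e4 := mk w' v (by simp) (by simp) h4 (by
    rintro c (rfl | rfl | rfl | rfl) <;> intro a b
    · exact has a h3
    · exact hcon.2 a
    · exact hi a
    · exact hi b)
  have n1 : u ≠ w := by rintro rfl; exact hi h1
  have n2 : w ≠ v := by rintro rfl; exact hi h2
  have n3 : u ≠ w' := by rintro rfl; exact hi h3
  have n4 : w' ≠ v := by rintro rfl; exact hi h4
  refine aux_bridge (hS.1 {u, w, w', v}) 3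
    (fun i => if i = 0 then u else if i = 1 then w else if i = 2 then v else w') ?_ ?_ ?_
  · intro i hi
    interval_cases i
    · simpa using e1
    · simpa using e2
    · simpa using e4.symm
  · simpa using e3
  · intro i hi
    interval_cases i <;> simp <;> grind

theorem aux_T {V : Type*} {A : Set (V × V)} (hA : IsDAG A) (hS : Skeletal A)
    {E : V → V → Prop} (hE : ∀ x y, E x y → aAdj A x y) (hE' : ∀ x y, aAdj A x y → E x y ∨ E y x)
    (has : ∀ x y, E x y → E y x → False)
    (h3 : ∀ x y z, E x y → E y z → E z x → False) (n : ℕ) :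
    ∀ p : ℕ → V, 2 ≤ n → (∀ i < n, E (p i) (p (i+1))) → aAdj A (p 0) (p n) →
      E (p 0) (p n) ∧ ∃ z, E (p 0) z ∧ E z (p n) := by
  induction n using Nat.strong_induction_on with
  | _ n ih =>
  intro p hn hp h0
  rcases Nat.eq_or_lt_of_le hn with h2 | h2
  · subst h2
    have a := hp 0 (by omega)
    have b := hp 1 (by omega)
    refine ⟨(hE' _ _ h0).resolve_right fun h => h3 _ _ _ a b h, _, a, b⟩
  · have hsub : ∀ i j, i + 2 ≤ j → j ≤ n → ¬ (i = 0 ∧ j = n) → aAdj A (p i) (p j) →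
        E (p i) (p j) := by
      intro i j hij hj hne hadj
      have := (ih (j - i) (by omega) (fun k => p (i + k)) (by omega)
        (fun k hk => hp (i + k) (by omega)) (by
          simp only [Nat.add_zero]
          rwa [show i + (j - i) = j by omega])).1
      simp only [Nat.add_zero] at this
      rwa [show i + (j - i) = j by omega] at this
    have : ∃ i j, i + 2 ≤ j ∧ j ≤ n ∧ ¬ (i = 0 ∧ j = n) ∧ (p i = p j ∨ aAdj A (p i) (p j)) := by
      by_contra hcon
      refine aux_chordless hA hS n h2 p (fun i hi => hE _ _ (hp i hi)) h0 ?_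
      intro i j a b c
      by_contra hcc
      exact hcon ⟨i, j, a, b, c, by by_contra h9; exact hcc ⟨fun h => h9 (Or.inl h), fun h => h9 (Or.inr h)⟩⟩
    obtain ⟨i, j, hij, hj, hne, h | h⟩ := this
    · exfalso
      obtain ⟨j, rfl⟩ : ∃ k, j = k + 1 := ⟨j - 1, by omega⟩
      have hl := hp j (by omega)
      rw [← h] at hl
      rcases Nat.eq_or_lt_of_le (show i + 1 ≤ j by omega) with h' | h'
      · subst h'
        exact has _ _ hl (hp i (by omega))
      · exact has _ _ hl (hsub i j h' (by omega) (by omega) (Or.symm (hE _ _ hl)))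
    · have hs := hsub i j hij hj hne h
      have := ih (n - (j - i - 1)) (by omega) (fun k => if k ≤ i then p k else p (k + (j - i - 1)))
        (by omega) (by
          intro k hk
          rcases lt_trichotomy k i with h' | h' | h'
          · have e1 : k ≤ i := by omega
            have e2 : k + 1 ≤ i := by omega
            simp only [e1, e2, if_true]
            exact hp k (by omega)
          · subst h'
            simp only [le_refl, if_true, show ¬ (k + 1 ≤ k) by omega, if_false]
            rwa [show k + 1 + (j - k - 1) = j by omega]
          · simp only [show ¬ (k ≤ i) by omega, show ¬ (k + 1 ≤ i) by omega, if_false]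
            have := hp (k + (j - i - 1)) (by omega)
            rwa [show k + 1 + (j - i - 1) = k + (j - i - 1) + 1 by omega])
        (by
          simp only [Nat.zero_le, if_true, show ¬ (n - (j - i - 1) ≤ i) by omega, if_false]
          rwa [show n - (j - i - 1) + (j - i - 1) = n by omega])
      simp only [Nat.zero_le, if_true, show ¬ (n - (j - i - 1) ≤ i) by omega, if_false] at this
      rwa [show n - (j - i - 1) + (j - i - 1) = n by omega] at this

theorem aux_re {V : Type*} {A B : Set (V × V)} {x y : V} :
    ArcRel (reorient A B) x y ↔ ((x, y) ∈ A ∧ (x, y) ∉ B) ∨ (y, x) ∈ B := by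
  unfold ArcRel reorient
  constructor
  · rintro (h | ⟨⟨a, b⟩, h, e⟩)
    · exact Or.inl h
    · simp only [Prod.swap_prod_mk, Prod.mk.injEq] at e
      obtain ⟨rfl, rfl⟩ := e
      exact Or.inr h
  · rintro (h | h)
    · exact Or.inl h
    · exact Or.inr ⟨(y, x), h, rfl⟩

theorem aux_re_adj {V : Type*} {A B : Set (V × V)} (hB : B ⊆ A) (x y : V)
    (h : ArcRel (reorient A B) x y) : aAdj A x y := by
  rcases aux_re.1 h with h | h
  · exact Or.inl h.1
  · exact Or.inr (hB h)

theorem aux_re_adj' {V : Type*} {A B : Set (V × V)} (x y : V)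
    (h : aAdj A x y) : ArcRel (reorient A B) x y ∨ ArcRel (reorient A B) y x := by
  simp only [aux_re]
  unfold aAdj at h
  tauto

theorem aux_re_asymm {V : Type*} {A B : Set (V × V)} (hA : IsDAG A) (hB : B ⊆ A) (x y : V)
    (h : ArcRel (reorient A B) x y) (h' : ArcRel (reorient A B) y x) : False := by
  rw [aux_re] at h h'
  have := @aux_asymm _ _ hA x y
  have := @hB (x, y)
  have := @hB (y, x)
  tauto

theorem aux_acyc {V : Type*} {A B : Set (V × V)} (hA : IsDAG A) (hS : Skeletal A) (hB : B ⊆ A)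
    (hc : ∀ x y z, (x, y) ∈ B → (y, z) ∈ B → (x, z) ∈ A → (x, z) ∈ B)
    (hcc : ∀ x y z, (x, y) ∈ A → (y, z) ∈ A → (x, z) ∈ B → (x, y) ∈ B ∨ (y, z) ∈ B) :
    ARmem A B := by
  refine ⟨hB, ?_⟩
  have hadj := aux_re_adj hB
  have has := aux_re_asymm hA hB
  have h3 : ∀ x y z, ArcRel (reorient A B) x y → ArcRel (reorient A B) y z →
      ArcRel (reorient A B) z x → False := by
    intro x y z h1 h2 h3
    have cyc : ∀ a b c, (a, b) ∈ A → (b, c) ∈ A → (c, a) ∈ A → False := fun a b c h1 h2 h3 =>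
      hA.2.2 a (((Relation.TransGen.single (show ArcRel A a b from h1)).tail h2).tail h3)
    rw [aux_re] at h1 h2 h3
    have a1 := cyc x y z
    have a2 := cyc x z y
    have k1 := hc x y z
    have k2 := hc y z x
    have k3 := hc z x y
    have k4 := hc x z y
    have k5 := hc z y x
    have k6 := hc y x z
    have l1 := hcc x y z
    have l2 := hcc y z x
    have l3 := hcc z x y
    have l4 := hcc x z y
    have l5 := hcc z y x
    have l6 := hcc y x z
    have m1 := @hB (x, y)
    have m2 := @hB (y, x)
    have m3 := @hB (y, z)
    have m4 := @hB (z, y)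
    have m5 := @hB (x, z)
    have m6 := @hB (z, x)
    have s1 := @aux_asymm _ _ hA x y
    have s2 := @aux_asymm _ _ hA y z
    have s3 := @aux_asymm _ _ hA z x
    grind
  intro v hv
  obtain ⟨n, p, hn, h0, h1, hp⟩ := aux_path_of_transGen hv
  obtain ⟨n, rfl⟩ : ∃ k, n = k + 1 := ⟨n - 1, by omega⟩
  have hl := hp n (by omega)
  rw [h1, ← h0] at hl
  rcases Nat.lt_or_ge n 2 with h' | h'
  · interval_cases n
    · exact has _ _ hl hl
    · exact has _ _ hl (hp 0 (by omega))
  · exact has _ _ hl (aux_T hA hS hadj aux_re_adj' has h3 n p h' (fun i hi => hp i (by omega))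
      (Or.symm (hadj _ _ hl))).1

theorem aux_mid {V : Type*} {A B : Set (V × V)} (hA : IsDAG A) (hS : Skeletal A)
    (hB : ARmem A B) {x y : V} (h : ArcRel (reorient A B) y x)
    (hn : (y, x) ∉ transRed (reorient A B)) :
    ∃ z, ArcRel (reorient A B) y z ∧ ArcRel (reorient A B) z x := by
  have : ∃ w : V, ArcRel (reorient A B) y w ∧ Relation.TransGen (ArcRel (reorient A B)) w x := by
    by_contra hcon
    exact hn ⟨h, hcon⟩
  obtain ⟨w, hw, hw'⟩ := this
  obtain ⟨n, p, hn, h0, h1, hp⟩ := aux_path_of_transGen hw'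
  have := (aux_T hA hS (aux_re_adj hB.1) aux_re_adj' (aux_re_asymm hA hB.1)
    (fun a b c h1 h2 h3 => hB.2 a (((Relation.TransGen.single h1).tail h2).tail h3)) (n+1)
    (fun i => if i = 0 then y else p (i - 1)) (by omega) (by
      intro i hi
      rcases i with _ | i
      · simpa [h0] using hw
      · simpa using hp i (by omega)) (by
      simp only [if_true, Nat.add_eq_zero_iff, one_ne_zero, and_false, if_false,
        Nat.add_sub_cancel, h1]
      exact aux_re_adj hB.1 _ _ h)).2
  simpa [h1] using this

theorem aux_or1 {V : Type*} {A B : Set (V × V)} (hB : ARmem A B) {a b : V}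
    (h : Relation.TransGen (ArcRel (reorient A B)) a b) : (a, b) ∉ B := fun h' =>
  hB.2 a (h.tail (aux_re.2 (Or.inr h')))

theorem aux_or2 {V : Type*} {A B : Set (V × V)} (hB : ARmem A B) {a b : V} (hab : (a, b) ∈ A)
    (h : Relation.TransGen (ArcRel (reorient A B)) b a) : (a, b) ∈ B := by
  by_contra h'
  exact hB.2 b (h.tail (aux_re.2 (Or.inl ⟨hab, h'⟩)))

theorem aux_supp {V : Type*} {A : Set (V × V)} (hA : IsDAG A) (hF : Filled A) {u v w : V}
    (h : (u, v) ∈ A) : w ∈ transSupport A u v \ {u, v} ↔ (u, w) ∈ A ∧ (w, v) ∈ A := by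
  constructor
  · rintro ⟨⟨h1, h2⟩, h3⟩
    simp only [Set.mem_insert_iff, Set.mem_singleton_iff, not_or] at h3
    have h1' := (Relation.reflTransGen_iff_eq_or_transGen.1 h1).resolve_left h3.1
    have h2' := (Relation.reflTransGen_iff_eq_or_transGen.1 h2).resolve_left (Ne.symm h3.2)
    exact aux_fill hA hF h1' h2' h
  · rintro ⟨h1, h2⟩
    refine ⟨⟨Relation.ReflTransGen.single h1, Relation.ReflTransGen.single h2⟩, ?_⟩
    rintro (rfl | rfl)
    · exact aux_irr hA h1
    · exact aux_irr hA h2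

theorem aux_cover {V : Type*} {E : Set (V × V)} {x y a b : V}
    (h : (y, x) ∈ transRed E) (h1 : Relation.ReflTransGen (ArcRel E) y b) (h2 : ArcRel E b a)
    (h3 : Relation.ReflTransGen (ArcRel E) a x) : b = y ∧ a = x := by
  have hb : b = y := by
    rcases Relation.ReflTransGen.cases_head h1 with h1 | ⟨c, hc, h1⟩
    · exact h1.symm
    · exact (h.2 ⟨c, hc, Relation.TransGen.trans_left (Relation.TransGen.tail' h1 h2) h3⟩).elim
  subst hb
  refine ⟨rfl, ?_⟩
  rcases Relation.reflTransGen_iff_eq_or_transGen.1 h3 with h3 | h3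
  · exact h3.symm
  · exact (h.2 ⟨a, h2, h3⟩).elim

theorem aux_part1 {V : Type*} {A B : Set (V × V)} (hA : IsDAG A) (hS : Skeletal A)
    (hB : ARmem A B) : IsNCDiagram A (joinDiagram A B) := by
  constructor
  · rintro ⟨u, v, D, U⟩ ⟨h1, h2, h3, h4⟩
    simp only at h1 h2 h3 h4
    subst h3; subst h4
    refine ⟨hB.1 h1, ?_, ?_⟩
    · ext w
      simp only [deltaDown, deltaUp, Set.mem_inter_iff, Set.mem_ofPred_eq, Set.mem_sdiff,
        Set.mem_empty_iff_false, iff_false]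
      tauto
    · ext w
      simp only
      rw [aux_supp hA hS.2 (hB.1 h1)]
      simp only [deltaDown, deltaUp, Set.mem_union, Set.mem_ofPred_eq, Set.mem_sdiff]
      constructor
      · rintro (h | h)
        · exact ⟨hB.1 h.1, h.2.1⟩
        · exact ⟨h.1.1, hB.1 h.2⟩
      · rintro ⟨a, b⟩
        by_cases c : (u, w) ∈ B <;> by_cases d : (w, v) ∈ B
        · exact (h2.2 ⟨w, aux_re.2 (Or.inr d), .single (aux_re.2 (Or.inr c))⟩).elim
        · tauto
        · tauto
        · exact (hB.2 u (((Relation.TransGen.single (aux_re.2 (Or.inl ⟨a, c⟩))).tail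
            (aux_re.2 (Or.inl ⟨b, d⟩))).tail (aux_re.2 (Or.inr h1)))).elim
  · rintro ⟨u, v, D, U⟩ ⟨h1, h2, h3, h4⟩ ⟨u', v', D', U'⟩ ⟨h1', h2', h3', h4'⟩ hne
      ⟨w, w', hw, ⟨a, b⟩, ⟨c, d⟩⟩
    simp only at h1 h2 h3 h4 h1' h2' h3' h4' a b c d
    subst h3; subst h4; subst h3'; subst h4'
    have hne' : ¬ (u = u' ∧ v = v') := by rintro ⟨rfl, rfl⟩; exact hne rfl
    set E := ArcRel (reorient A B) with hEdef
    have hacy : ∀ x, ¬ Relation.TransGen E x x := hB.2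
    have dn : ∀ {u v w}, w ∈ deltaDown A B u v → (u, w) ∈ A ∧ (w, v) ∈ A ∧ E w v := fun h =>
      ⟨hB.1 h.1, h.2.1, aux_re.2 (Or.inl h.2)⟩
    have up : ∀ {u v w}, w ∈ deltaUp A B u v → (u, w) ∈ A ∧ (w, v) ∈ A ∧ E u w := fun h =>
      ⟨h.1.1, hB.1 h.2, aux_re.2 (Or.inl h.1)⟩
    have e : E v u := aux_re.2 (Or.inr h1)
    have e' : E v' u' := aux_re.2 (Or.inr h1')
    have g := hB.1 h1
    have g' := hB.1 h1'
    simp only [Set.mem_union, Set.mem_insert_iff, Set.mem_singleton_iff] at a b c d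
    have has := fun x y => @aux_asymm _ _ hA x y
    have t1 : ∀ {x y}, E x y → Relation.TransGen E x y := fun h => .single h
    have a' : w = u ∨ w = v ∨ ((u, w) ∈ A ∧ (w, v) ∈ A ∧ E w v) := by
      rcases a with a | a | a
      · exact Or.inr (Or.inr (dn a))
      · exact Or.inl a
      · exact Or.inr (Or.inl a)
    have b' : w = v' ∨ w = u' ∨ ((u', w) ∈ A ∧ (w, v') ∈ A ∧ E u' w) := by
      rcases b with a | a | a
      · exact Or.inr (Or.inr (up a))
      · exact Or.inr (Or.inl a)
      · exact Or.inl a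
    have c' : w' = v ∨ w' = u ∨ ((u, w') ∈ A ∧ (w', v) ∈ A ∧ E u w') := by
      rcases c with a | a | a
      · exact Or.inr (Or.inr (up a))
      · exact Or.inr (Or.inl a)
      · exact Or.inl a
    have d' : w' = u' ∨ w' = v' ∨ ((u', w') ∈ A ∧ (w', v') ∈ A ∧ E w' v') := by
      rcases d with a | a | a
      · exact Or.inr (Or.inr (dn a))
      · exact Or.inl a
      · exact Or.inr (Or.inl a)
    clear a b c d
    have lift : ∀ {x y}, (x = y ∨ E x y) → Relation.ReflTransGen E x y := by
      rintro x y (rfl | h)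
      · exact .refl
      · exact .single h
    have hle : ∀ {x y}, Relation.TransGen E x y → Relation.ReflTransGen E y x → False :=
      fun h h' => hacy _ (Relation.TransGen.trans_left h h')
    by_cases wu : w = u
    · subst wu
      by_cases wv : w' = v
      · subst wv
        have q1 : w = u' ∨ E u' w := by
          rcases b' with h | h | h
          · exfalso
            subst h
            rcases d' with h | h | h
            · subst h; exact has _ _ g g'
            · exact hw h.symm
            · exact has _ _ g h.2.1
          · exact Or.inl h
          · exact Or.inr h.2.2
        have q2 : w' = v' ∨ E w' v' := by
          rcases d' with h | h | h
          · exfalso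
            subst h
            rcases b' with h | h | h
            · subst h; exact has _ _ g g'
            · exact hw h
            · exact has _ _ g h.1
          · exact Or.inl h
          · exact Or.inr h.2.2
        have := aux_cover h2 (lift q2) e' (lift (q1.imp_left Eq.symm))
        exact hne' ⟨this.2.symm, this.1.symm⟩
      · have cc : (w, w') ∈ A ∧ (w', v) ∈ A ∧ E w w' :=
          (c'.resolve_left wv).resolve_left fun h => hw h.symm
        have p : w = v' ∨ Relation.ReflTransGen E u' w := by
          rcases b' with h | h | h
          · exact Or.inl h
          · exact Or.inr (lift (Or.inl h.symm))
          · exact Or.inr (lift (Or.inr h.2.2))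
        have q : w' = u' ∨ Relation.ReflTransGen E w' v' := by
          rcases d' with h | h | h
          · exact Or.inl h
          · exact Or.inr (lift (Or.inl h))
          · exact Or.inr (lift (Or.inr h.2.2))
        rcases p with rfl | p
        · rcases q with rfl | q
          · exact has _ _ cc.1 g'
          · exact hle (t1 cc.2.2) q
        · rcases q with rfl | q
          · exact hle (t1 cc.2.2) p
          · exact hle (t1 cc.2.2) (q.trans (Relation.ReflTransGen.head e' p))
    · have aa : Relation.ReflTransGen E w v := by
        rcases a' with h | h | h
        · exact (wu h).elim
        · exact lift (Or.inl h)
        · exact lift (Or.inr h.2.2)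
      have p : w = v' ∨ Relation.ReflTransGen E u' w := by
        rcases b' with h | h | h
        · exact Or.inl h
        · exact Or.inr (lift (Or.inl h.symm))
        · exact Or.inr (lift (Or.inr h.2.2))
      have q : w' = u' ∨ Relation.ReflTransGen E w' v' := by
        rcases d' with h | h | h
        · exact Or.inl h
        · exact Or.inr (lift (Or.inl h))
        · exact Or.inr (lift (Or.inr h.2.2))
      by_cases wv : w' = v
      · subst wv
        have aa' : (u, w) ∈ A ∧ (w, w') ∈ A ∧ E w w' := 
          (a'.resolve_left wu).resolve_left hw
        rcases p with rfl | p
        · rcases q with rfl | q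
          · exact has _ _ aa'.2.1 g'
          · exact hle (t1 aa'.2.2) q
        · rcases q with rfl | q
          · exact hle (t1 aa'.2.2) p
          · exact hle (t1 aa'.2.2) (q.trans (Relation.ReflTransGen.head e' p))
      · have cc : Relation.ReflTransGen E u w' := by
          rcases c' with h | h | h
          · exact (wv h).elim
          · exact lift (Or.inl h.symm)
          · exact lift (Or.inr h.2.2)
        have ww : Relation.TransGen E w w' :=
          Relation.TransGen.trans_left (Relation.TransGen.tail' aa e) cc
        rcases p with rfl | p
        · rcases q with rfl | q
          · skip
            have := aux_cover h2' aa e cc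
            exact hne' ⟨this.2, this.1⟩
          · exact hle ww q
        · rcases q with rfl | q
          · exact hle ww p
          · exact hle ww (q.trans (Relation.ReflTransGen.head e' p))

def aJ {V : Type*} (A : Set (V × V)) (δ : Set (RopeData V)) (a b : V) : Prop :=
  (a, b) ∈ A ∧ ∃ r ∈ δ, (a ∈ r.up ∨ a = r.u) ∧ (b ∈ r.down ∨ b = r.v)

def aClos {V : Type*} (A : Set (V × V)) (δ : Set (RopeData V)) : Set (V × V) :=
  {a | a ∈ A ∧ Relation.TransGen (aJ A δ) a.1 a.2}

theorem aux_J_A {V : Type*} {A : Set (V × V)} {δ : Set (RopeData V)} {a b : V}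
    (h : Relation.TransGen (aJ A δ) a b) : Relation.TransGen (ArcRel A) a b :=
  h.lift id (fun _ _ h => h.1)

theorem aux_J_A' {V : Type*} {A : Set (V × V)} {δ : Set (RopeData V)} {a b : V}
    (h : Relation.ReflTransGen (aJ A δ) a b) : Relation.ReflTransGen (ArcRel A) a b :=
  h.lift id (fun _ _ h => h.1)

theorem aux_rope {V : Type*} {A : Set (V × V)} (hA : IsDAG A) (hS : Skeletal A)
    {r : RopeData V} (hr : IsRope A r) {w : V} :
    (w ∈ r.down ∨ w ∈ r.up) ↔ ((r.u, w) ∈ A ∧ (w, r.v) ∈ A) := by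
  rw [← aux_supp hA hS.2 hr.1, ← hr.2.2]; rfl

theorem aux_clos_sub {V : Type*} {A B : Set (V × V)} (hB : ARmem A B) :
    aClos A (joinDiagram A B) ⊆ B := by
  rintro ⟨x, y⟩ ⟨h, h'⟩
  simp only at h'
  have key : ∀ {a b}, aJ A (joinDiagram A B) a b → ArcRel (reorient A B) b a := by
    rintro a b ⟨hab, ⟨u, v, D, U⟩, ⟨h1, h2, h3, h4⟩, h5, h6⟩
    simp only at h1 h2 h3 h4 h5 h6
    subst h3; subst h4
    have e : ArcRel (reorient A B) v u := aux_re.2 (Or.inr h1)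
    have p : Relation.ReflTransGen (ArcRel (reorient A B)) u a := by
      rcases h5 with h | rfl
      · exact .single (aux_re.2 (Or.inl h.1))
      · exact .refl
    have q : Relation.ReflTransGen (ArcRel (reorient A B)) b v := by
      rcases h6 with h | rfl
      · exact .single (aux_re.2 (Or.inl h.2))
      · exact .refl
    exact aux_re.2 (Or.inr (aux_or2 hB hab
      (Relation.TransGen.trans_left (Relation.TransGen.tail' q e) p)))
  have : Relation.TransGen (ArcRel (reorient A B)) y x := by
    clear h
    induction h' with
    | single h => exact .single (key h)
    | tail _ h ih => exact ih.head (key h)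
  exact aux_or2 hB h this

noncomputable def aMu {V : Type*} (E : Set (V × V)) (y x : V) : ℕ :=
  Set.ncard {z | Relation.TransGen (ArcRel E) y z ∧ Relation.TransGen (ArcRel E) z x}

theorem aux_mu1 {V : Type*} [Finite V] {E : Set (V × V)} (hE : AcyclicArcs E) {x y z : V}
    (h1 : ArcRel E y z) (h2 : ArcRel E z x) : aMu E y z < aMu E y x := by
  apply Set.ncard_lt_ncard _ (Set.toFinite _)
  rw [Set.ssubset_iff_of_subset]
  · exact ⟨z, ⟨.single h1, .single h2⟩, fun h => hE z h.2⟩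
  · exact fun w hw => ⟨hw.1, hw.2.tail h2⟩

theorem aux_mu2 {V : Type*} [Finite V] {E : Set (V × V)} (hE : AcyclicArcs E) {x y z : V}
    (h1 : ArcRel E y z) (h2 : ArcRel E z x) : aMu E z x < aMu E y x := by
  apply Set.ncard_lt_ncard _ (Set.toFinite _)
  rw [Set.ssubset_iff_of_subset]
  · exact ⟨z, ⟨.single h1, .single h2⟩, fun h => hE z h.1⟩
  · exact fun w hw => ⟨hw.1.head h1, hw.2⟩

theorem aux_locred {V : Type*} [Finite V] {A B : Set (V × V)} (hA : IsDAG A) (hS : Skeletal A)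
    (hB : ARmem A B) (n : ℕ) : ∀ x y, aMu (reorient A B) y x = n → (x, y) ∈ B →
      (∀ w, (x, w) ∈ B → (w, y) ∈ B → False) →
      ∃ r ∈ joinDiagram A B, (x ∈ r.up ∨ x = r.u) ∧ (y ∈ r.down ∨ y = r.v) := by
  induction n using Nat.strong_induction_on with
  | _ n ih =>
  intro x y hn hxy hloc
  have e : ArcRel (reorient A B) y x := aux_re.2 (Or.inr hxy)
  have g := hB.1 hxy
  by_cases ht : (y, x) ∈ transRed (reorient A B)
  · exact ⟨⟨x, y, deltaDown A B x y, deltaUp A B x y⟩, ⟨hxy, ht, rfl, rfl⟩, Or.inr rfl, Or.inr rfl⟩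
  obtain ⟨z, hz1, hz2⟩ := aux_mid hA hS hB e ht
  have t1 : ∀ {x y}, ArcRel (reorient A B) x y → Relation.TransGen (ArcRel (reorient A B)) x y :=
    fun h => .single h
  have cases3 : ((z, x) ∈ A ∧ (z, x) ∉ B ∧ (z, y) ∈ B) ∨
      ((x, z) ∈ B ∧ (y, z) ∈ A ∧ (y, z) ∉ B) := by
    rcases aux_re.1 hz1 with h | h <;> rcases aux_re.1 hz2 with h' | h'
    · exact (hA.2.2 x (((Relation.TransGen.single (show ArcRel A x y from g)).tail h.1).tail
        h'.1)).elim
    · exact Or.inr ⟨h', h⟩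
    · exact Or.inl ⟨h'.1, h'.2, h⟩
    · exact (hloc z h' h).elim
  have re1 : ∀ {a b}, (a, b) ∈ A → (a, b) ∉ B → ArcRel (reorient A B) a b :=
    fun h h' => aux_re.2 (Or.inl ⟨h, h'⟩)
  have re2 : ∀ {a b}, (a, b) ∈ B → ArcRel (reorient A B) b a :=
    fun h => aux_re.2 (Or.inr h)
  rcases cases3 with hz | hz
  · obtain ⟨z, ⟨z1, z2, z3⟩, hmin⟩ := (measure (fun z => aMu (reorient A B) y z)).wf.has_min
      {z | (z, x) ∈ A ∧ (z, x) ∉ B ∧ (z, y) ∈ B} ⟨z, hz⟩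
    have lz : ∀ w, (z, w) ∈ B → (w, y) ∈ B → False := by
      intro w h1 h2
      have hwx : w ≠ x := by rintro rfl; exact z2 h1
      have ewx : Relation.TransGen (ArcRel (reorient A B)) w x := (t1 (re2 h1)).tail (re1 z1 z2)
      rcases aux_tour hA hS (hB.1 h1) (hB.1 h2) z1 g hwx with h | h
      · exact hmin w ⟨h, aux_or1 hB ewx, h2⟩ (aux_mu1 hB.2 (re2 h2) (re2 h1))
      · exact hloc w (aux_or2 hB h ewx) h2
    obtain ⟨⟨u, v, D, U⟩, hr, p, q⟩ := ih (aMu (reorient A B) y z)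
      (hn ▸ aux_mu1 hB.2 (re2 z3) (re1 z1 z2)) z y rfl z3 lz
    refine ⟨_, hr, Or.inl ?_, q⟩
    obtain ⟨h1, h2, h3, h4⟩ := hr
    simp only at h1 h2 h3 h4 p q ⊢
    subst h3; subst h4
    have pA : Relation.TransGen (ArcRel A) u x := by
      rcases p with p | rfl
      · exact (Relation.TransGen.single (show ArcRel A u z from p.1.1)).tail z1
      · exact .single z1
    have pE : Relation.TransGen (ArcRel (reorient A B)) u x := by
      rcases p with p | rfl
      · exact (t1 (re1 p.1.1 p.1.2)).tail (re1 z1 z2)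
      · exact .single (re1 z1 z2)
    have qA : Relation.TransGen (ArcRel A) x v := by
      rcases q with q | rfl
      · exact (Relation.TransGen.single (show ArcRel A x y from g)).tail q.2.1
      · exact .single g
    have f := aux_fill hA hS.2 pA qA (hB.1 h1)
    exact ⟨⟨f.1, aux_or1 hB pE⟩, aux_or2 hB f.2 (pE.head (re2 h1))⟩
  · obtain ⟨z, ⟨z1, z2, z3⟩, hmin⟩ := (measure (fun z => aMu (reorient A B) z x)).wf.has_min
      {z | (x, z) ∈ B ∧ (y, z) ∈ A ∧ (y, z) ∉ B} ⟨z, hz⟩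
    have lz : ∀ w, (x, w) ∈ B → (w, z) ∈ B → False := by
      intro w h1 h2
      have hwy : w ≠ y := by rintro rfl; exact z3 h2
      have eyw : Relation.TransGen (ArcRel (reorient A B)) y w := (t1 (re1 z2 z3)).tail (re2 h2)
      rcases aux_tour hA hS (hB.1 h1) (hB.1 h2) g z2 hwy with h | h
      · exact hloc w h1 (aux_or2 hB h eyw)
      · exact hmin w ⟨h1, h, aux_or1 hB eyw⟩ (aux_mu2 hB.2 (re2 h2) (re2 h1))
    obtain ⟨⟨u, v, D, U⟩, hr, p, q⟩ := ih (aMu (reorient A B) z x)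
      (hn ▸ aux_mu2 hB.2 (re1 z2 z3) (re2 z1)) x z rfl z1 lz
    refine ⟨_, hr, p, Or.inl ?_⟩
    obtain ⟨h1, h2, h3, h4⟩ := hr
    simp only at h1 h2 h3 h4 p q ⊢
    subst h3; subst h4
    have pA : Relation.TransGen (ArcRel A) u y := by
      rcases p with p | rfl
      · exact (Relation.TransGen.single (show ArcRel A u x from p.1.1)).tail g
      · exact .single g
    have qE : Relation.TransGen (ArcRel (reorient A B)) y v := by
      rcases q with q | rfl
      · exact (t1 (re1 z2 z3)).tail (re1 q.2.1 q.2.2)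
      · exact .single (re1 z2 z3)
    have qA : Relation.TransGen (ArcRel A) y v := by
      rcases q with q | rfl
      · exact (Relation.TransGen.single (show ArcRel A y z from z2)).tail q.2.1
      · exact .single z2
    have f := aux_fill hA hS.2 pA qA (hB.1 h1)
    exact ⟨aux_or2 hB f.1 (qE.tail (re2 h1)), f.2, aux_or1 hB qE⟩

theorem aux_sub_clos {V : Type*} [Finite V] {A B : Set (V × V)} (hA : IsDAG A) (hS : Skeletal A)
    (hB : ARmem A B) (n : ℕ) : ∀ x y, aMu (reorient A B) y x = n → (x, y) ∈ B →
      Relation.TransGen (aJ A (joinDiagram A B)) x y := by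
  induction n using Nat.strong_induction_on with
  | _ n ih =>
  intro x y hn hxy
  by_cases hloc : ∃ w, (x, w) ∈ B ∧ (w, y) ∈ B
  · obtain ⟨w, h1, h2⟩ := hloc
    have e1 : ArcRel (reorient A B) w x := aux_re.2 (Or.inr h1)
    have e2 : ArcRel (reorient A B) y w := aux_re.2 (Or.inr h2)
    exact (ih _ (hn ▸ aux_mu2 hB.2 e2 e1) x w rfl h1).trans
      (ih _ (hn ▸ aux_mu1 hB.2 e2 e1) w y rfl h2)
  · exact .single ⟨hB.1 hxy, aux_locred hA hS hB n x y hn hxy fun w h1 h2 => hloc ⟨w, h1, h2⟩⟩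

theorem aux_clos_eq {V : Type*} [Finite V] {A B : Set (V × V)} (hA : IsDAG A) (hS : Skeletal A)
    (hB : ARmem A B) : aClos A (joinDiagram A B) = B := by
  refine Set.Subset.antisymm (aux_clos_sub hB) ?_
  rintro ⟨x, y⟩ h
  exact ⟨hB.1 h, aux_sub_clos hA hS hB _ x y rfl h⟩

theorem aux_pass {V : Type*} {A : Set (V × V)} (hA : IsDAG A) (hS : Skeletal A)
    {δ : Set (RopeData V)} {x y z : V} (h : Relation.TransGen (aJ A δ) x z)
    (hxz : (x, z) ∈ A) (h1 : (x, y) ∈ A) (h2 : (y, z) ∈ A) :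
    (Relation.TransGen (aJ A δ) x y ∧ Relation.TransGen (aJ A δ) y z) ∨
    ∃ a b, Relation.ReflTransGen (aJ A δ) x a ∧ aJ A δ a b ∧ Relation.ReflTransGen (aJ A δ) b z ∧
      (a, y) ∈ A ∧ (y, b) ∈ A := by
  induction h using Relation.TransGen.head_induction_on with
  | @single x h => exact Or.inr ⟨x, z, .refl, h, .refl, h1, h2⟩
  | @head x c h hc ih =>
    have f := aux_fill hA hS.2 (Relation.TransGen.single (show ArcRel A x c from h.1))
      (aux_J_A hc) hxz
    by_cases e : y = c
    · subst e; exact Or.inl ⟨.single h, hc⟩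
    · rcases aux_tour hA hS h1 h2 f.1 f.2 e with h' | h'
      · exact Or.inr ⟨x, c, .refl, h, hc.to_reflTransGen, h1, h'⟩
      · rcases ih f.2 h' with ⟨a, b⟩ | ⟨a, b, p, q⟩
        · exact Or.inl ⟨a.head h, b⟩
        · exact Or.inr ⟨a, b, p.head h, q⟩

theorem aux_Jsplit {V : Type*} {A : Set (V × V)} (hA : IsDAG A) (hS : Skeletal A)
    {r : RopeData V} (hr : IsRope A r) {a b y : V}
    (ha : a ∈ r.up ∨ a = r.u) (hb : b ∈ r.down ∨ b = r.v)
    (h1 : (a, y) ∈ A) (h2 : (y, b) ∈ A) : y ∈ r.down ∨ y ∈ r.up := by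
  have hu : Relation.TransGen (ArcRel A) r.u y := by
    rcases ha with h | h
    · exact (Relation.TransGen.single
        (show ArcRel A r.u a from ((aux_rope hA hS hr).1 (Or.inr h)).1)).tail h1
    · subst h; exact .single h1
  have hv : Relation.TransGen (ArcRel A) y r.v := by
    rcases hb with h | h
    · exact (Relation.TransGen.single (show ArcRel A y b from h2)).tail
        ((aux_rope hA hS hr).1 (Or.inl h)).2
    · subst h; exact .single h2
  exact (aux_rope hA hS hr).2 (aux_fill hA hS.2 hu hv hr.1)

theorem aux_clos_AR {V : Type*} {A : Set (V × V)} (hA : IsDAG A) (hS : Skeletal A)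
    {δ : Set (RopeData V)} (hδ : ∀ r ∈ δ, IsRope A r) : ARmem A (aClos A δ) := by
  refine aux_acyc hA hS (fun a h => h.1) ?_ ?_
  · intro x y z h1 h2 h3
    exact ⟨h3, h1.2.trans h2.2⟩
  · rintro x y z h1 h2 ⟨h3, h4⟩
    rcases aux_pass hA hS h4 h3 h1 h2 with h | ⟨a, b, p, ⟨hab, r, hr, ha, hb⟩, q, h5, h6⟩
    · exact Or.inl ⟨h1, h.1⟩
    · rcases aux_Jsplit hA hS (hδ r hr) ha hb h5 h6 with h | h
      · exact Or.inl ⟨h1, Relation.TransGen.tail' p ⟨h5, r, hr, ha, Or.inl h⟩⟩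
      · exact Or.inr ⟨h2, Relation.TransGen.head' ⟨h6, r, hr, Or.inl h, hb⟩ q⟩

theorem aux_nc1 {V : Type*} {A : Set (V × V)} (hA : IsDAG A)
    {δ : Set (RopeData V)} (hδ : IsNCDiagram A δ) {r : RopeData V} (hr : r ∈ δ) {a b : V}
    (ha : a ∈ r.down ∨ a = r.u) (hb : b ∈ r.up ∨ b = r.v) (h : aJ A δ a b) :
    a = r.u ∧ b = r.v := by
  obtain ⟨hab, r', hr', ha', hb'⟩ := h
  by_cases e : r = r'
  · subst e
    have hd : ∀ x, x ∈ r.down → x ∈ r.up → False := fun x h h' => by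
      have : x ∈ r.down ∩ r.up := ⟨h, h'⟩
      rw [(hδ.1 r hr).2.1] at this
      exact this
    have := hd a
    have := hd b
    tauto
  · exfalso
    refine hδ.2 hr hr' e ⟨a, b, fun e => aux_irr hA (e ▸ hab), ?_⟩
    simp only [Set.mem_inter_iff, Set.mem_union, Set.mem_insert_iff, Set.mem_singleton_iff]
    tauto

theorem aux_nc2 {V : Type*} {A : Set (V × V)} (hA : IsDAG A) (hS : Skeletal A)
    {δ : Set (RopeData V)} (hδ : IsNCDiagram A δ) {r : RopeData V} (hr : r ∈ δ) {a b : V}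
    (ha : a ∈ r.down ∨ a = r.u) (hb : b ∈ r.up ∨ b = r.v)
    (h : Relation.TransGen (aJ A δ) a b) :
    a = r.u ∧ b = r.v := by
  induction h using Relation.TransGen.head_induction_on with
  | single h => exact aux_nc1 hA hδ hr ha hb h
  | @head x c h hc ih =>
    exfalso
    have hu : Relation.TransGen (ArcRel A) r.u c := by
      rcases ha with h' | h'
      · exact (Relation.TransGen.single
          (show ArcRel A r.u x from ((aux_rope hA hS (hδ.1 r hr)).1 (Or.inl h')).1)).tail h.1
      · subst h'; exact .single h.1
    have hv : Relation.TransGen (ArcRel A) c r.v := by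
      rcases hb with h' | h'
      · exact (aux_J_A hc).tail ((aux_rope hA hS (hδ.1 r hr)).1 (Or.inr h')).2
      · subst h'; exact aux_J_A hc
    have f := aux_fill hA hS.2 hu hv (hδ.1 r hr).1
    rcases (aux_rope hA hS (hδ.1 r hr)).2 f with h' | h'
    · have := (ih (Or.inl h')).1
      rw [this] at f
      exact aux_irr hA f.1
    · have := (aux_nc1 hA hδ hr ha (Or.inl h') h).2
      rw [this] at f
      exact aux_irr hA f.2

theorem aux_sup {V : Type*} {A : Set (V × V)} (hA : IsDAG A) (hS : Skeletal A)
    {δ : Set (RopeData V)} (hδ : IsNCDiagram A δ) : δ ⊆ joinDiagram A (aClos A δ) := by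
  intro r hr
  have hB := aux_clos_AR hA hS hδ.1
  have hR := hδ.1 r hr
  have rope := fun w => @aux_rope _ _ hA hS r hR w
  have hd : ∀ x, x ∈ r.down → x ∈ r.up → False := fun x h h' => by
    have : x ∈ r.down ∩ r.up := ⟨h, h'⟩
    rw [hR.2.1] at this
    exact this
  have huv : (r.u, r.v) ∈ aClos A δ := ⟨hR.1, .single ⟨hR.1, r, hr, Or.inr rfl, Or.inr rfl⟩⟩
  have d1 : ∀ w ∈ r.down, (r.u, w) ∈ aClos A δ := fun w hw =>
    ⟨((rope w).1 (Or.inl hw)).1, .single ⟨((rope w).1 (Or.inl hw)).1, r, hr, Or.inr rfl, Or.inl hw⟩⟩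
  have u1 : ∀ w ∈ r.up, (w, r.v) ∈ aClos A δ := fun w hw =>
    ⟨((rope w).1 (Or.inr hw)).2, .single ⟨((rope w).1 (Or.inr hw)).2, r, hr, Or.inl hw, Or.inr rfl⟩⟩
  have d2 : ∀ w ∈ r.down, (w, r.v) ∉ aClos A δ := fun w hw h => by
    have := (aux_nc2 hA hS hδ hr (Or.inl hw) (Or.inr rfl) h.2).1
    have h' := (rope w).1 (Or.inl hw)
    rw [this] at h'
    exact aux_irr hA h'.1
  have u2 : ∀ w ∈ r.up, (r.u, w) ∉ aClos A δ := fun w hw h => by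
    have := (aux_nc2 hA hS hδ hr (Or.inr rfl) (Or.inl hw) h.2).2
    have h' := (rope w).1 (Or.inr hw)
    rw [this] at h'
    exact aux_irr hA h'.2
  refine ⟨huv, ?_, ?_, ?_⟩
  · by_contra hcon
    obtain ⟨z, hz1, hz2⟩ := aux_mid hA hS hB (aux_re.2 (Or.inr huv)) hcon
    rcases aux_re.1 hz1 with h | h <;> rcases aux_re.1 hz2 with h' | h'
    · exact hA.2.2 r.u (((Relation.TransGen.single (show ArcRel A r.u r.v from hR.1)).tail
        h.1).tail h'.1)
    · skip
      rcases aux_pass hA hS h'.2 h'.1 hR.1 h.1 with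
        p | ⟨a, b, p, ⟨hab, r', hr', ha, hb⟩, q, h5, h6⟩
      · exact h.2 ⟨h.1, p.2⟩
      · rcases aux_Jsplit hA hS (hδ.1 r' hr') ha hb h5 h6 with h7 | h7
        · have hua : a = r.u ∨ a ∈ r.down ∨ (a ∈ r.up ∧ Relation.TransGen (aJ A δ) r.u a) := by
            rcases Relation.reflTransGen_iff_eq_or_transGen.1 p with e | p
            · exact Or.inl e
            · rcases (rope a).2 (aux_fill hA hS.2 (aux_J_A p) (.single h5) hR.1) with k | k
              · exact Or.inr (Or.inl k)
              · exact Or.inr (Or.inr ⟨k, p⟩)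
          have fin : (a ∈ r.down ∨ a = r.u) → False := fun k => by
            by_cases e : r = r'
            · subst e
              exact aux_irr hA ((rope _).1 (Or.inl h7)).2
            · refine hδ.2 hr hr' e ⟨a, r.v, fun e => aux_irr hA (e ▸ h5), ?_⟩
              exact ⟨⟨k.imp_right Or.inl, ha.imp_right Or.inl⟩, Or.inr (Or.inr rfl), Or.inl h7⟩
          rcases hua with k | k | k
          · exact fin (Or.inr k)
          · exact fin (Or.inl k)
          · exact u2 a k.1 ⟨((rope a).1 (Or.inr k.1)).1, k.2⟩
        · exact h.2 ⟨h.1, Relation.TransGen.head' ⟨h6, r', hr', Or.inl h7, hb⟩ q⟩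
    · skip
      rcases aux_pass hA hS h.2 h.1 h'.1 hR.1 with
        p | ⟨a, b, p, ⟨hab, r', hr', ha, hb⟩, q, h5, h6⟩
      · exact h'.2 ⟨h'.1, p.1⟩
      · rcases aux_Jsplit hA hS (hδ.1 r' hr') ha hb h5 h6 with h7 | h7
        · exact h'.2 ⟨h'.1, Relation.TransGen.tail' p ⟨h5, r', hr', ha, Or.inl h7⟩⟩
        · have hub : b = r.v ∨ b ∈ r.up ∨ (b ∈ r.down ∧ Relation.TransGen (aJ A δ) b r.v) := by
            rcases Relation.reflTransGen_iff_eq_or_transGen.1 q with e | p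
            · exact Or.inl e.symm
            · rcases (rope b).2 (aux_fill hA hS.2 (.single h6) (aux_J_A p) hR.1) with k | k
              · exact Or.inr (Or.inr ⟨k, p⟩)
              · exact Or.inr (Or.inl k)
          have fin : (b ∈ r.up ∨ b = r.v) → False := fun k => by
            by_cases e : r = r'
            · subst e
              exact aux_irr hA ((rope _).1 (Or.inr h7)).1
            · refine hδ.2 hr hr' e ⟨r.u, b, fun e => aux_irr hA (e ▸ h6), ?_⟩
              exact ⟨⟨Or.inr (Or.inl rfl), Or.inl h7⟩, k.imp_right Or.inr, hb.imp_right Or.inr⟩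
          rcases hub with k | k | k
          · exact fin (Or.inr k)
          · exact fin (Or.inl k)
          · exact d2 b k.1 ⟨((rope b).1 (Or.inl k.1)).2, k.2⟩
    · rcases (rope z).2 ⟨h'.1, h.1⟩ with k | k
      · exact d2 z k h
      · exact u2 z k h'
  · ext w
    constructor
    · exact fun hw => ⟨d1 w hw, ((rope w).1 (Or.inl hw)).2, d2 w hw⟩
    · rintro ⟨h1, h2⟩
      rcases (rope w).2 ⟨h1.1, h2.1⟩ with k | k
      · exact k
      · exact (h2.2 (u1 w k)).elim
  · ext w
    constructor
    · exact fun hw => ⟨⟨((rope w).1 (Or.inr hw)).1, u2 w hw⟩, u1 w hw⟩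
    · rintro ⟨h1, h2⟩
      rcases (rope w).2 ⟨h1.1, h2.1⟩ with k | k
      · exact (h1.2 (d1 w k)).elim
      · exact k

theorem aux_sub {V : Type*} {A : Set (V × V)} (hA : IsDAG A) (hS : Skeletal A)
    {δ : Set (RopeData V)} (hδ : IsNCDiagram A δ) : joinDiagram A (aClos A δ) ⊆ δ := by
  rintro ⟨u, v, D, U⟩ ⟨⟨g, h1⟩, h2, h3, h4⟩
  simp only at g h1 h2 h3 h4
  have hJ : aJ A δ u v := by
    rcases Relation.TransGen.head'_iff.1 h1 with ⟨c, hc, hcv⟩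
    rcases Relation.reflTransGen_iff_eq_or_transGen.1 hcv with e | hcv
    · rwa [e]
    · exfalso
      have f := aux_fill hA hS.2 (.single hc.1) (aux_J_A hcv) g
      exact h2.2 ⟨c, aux_re.2 (Or.inr ⟨f.2, hcv⟩), .single (aux_re.2 (Or.inr ⟨f.1, .single hc⟩))⟩
  obtain ⟨-, r', hr', ha, hb⟩ := hJ
  obtain ⟨u', v', D', U'⟩ := r'
  obtain ⟨k1, k2, k3, k4⟩ := aux_sup hA hS hδ hr'
  simp only at k1 k2 k3 k4 ha hb
  have p : Relation.ReflTransGen (ArcRel (reorient A (aClos A δ))) u' u := by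
    rcases ha with h | rfl
    · rw [k4] at h; exact .single (aux_re.2 (Or.inl h.1))
    · exact .refl
  have q : Relation.ReflTransGen (ArcRel (reorient A (aClos A δ))) v v' := by
    rcases hb with h | rfl
    · rw [k3] at h; exact .single (aux_re.2 (Or.inl h.2))
    · exact .refl
  obtain ⟨rfl, rfl⟩ := aux_cover h2 q (aux_re.2 (Or.inr k1)) p
  rw [h3, h4, ← k3, ← k4]
  exact hr'

/-- `δ_∨` is a bijection from `AR(D)` onto the non-crossing rope
diagrams of `D`. -/
theorem stmt_17 {V : Type*} [Fintype V] (A : Set (V × V)) (hA : IsDAG A)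
    (hS : Skeletal A) :
    (∀ B, ARmem A B → IsNCDiagram A (joinDiagram A B)) ∧
    (∀ B C, ARmem A B → ARmem A C → joinDiagram A B = joinDiagram A C → B = C) ∧
    (∀ δ : Set (RopeData V), IsNCDiagram A δ →
      ∃ B, ARmem A B ∧ joinDiagram A B = δ) := by
  refine ⟨fun B hB => aux_part1 hA hS hB, ?_, ?_⟩
  · intro B C hB hC h
    rw [← aux_clos_eq hA hS hB, h, aux_clos_eq hA hS hC]
  · intro δ hδ
    exact ⟨aClos A δ, aux_clos_AR hA hS hδ.1,
      Set.Subset.antisymm (aux_sub hA hS hδ) (aux_sup hA hS hδ)⟩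
end

section
/- Let D = (V, A) be a skeletal directed acyclic graph and let J, J' be join irreducible elements of the lattice AR(D), with associated ropes rope(J) and rope(J') (where rope(B) = (u, v, Δ^B_{u,v}, ∇^B_{u,v}) for the unique arc (u,v) ∈ B whose reverse lies in the transitive reduction of E_B). Then the following are equivalent: (a) J forces J', i.e., every congruence ≡ of AR(D) with J ≡ J_* satisfies J' ≡ J'_*; (b) rope(J) is a subrope of rope(J'). -/
/-- A lattice congruence of the acyclic reorientation lattice: an equivalence
relation compatible with joins (least upper bounds) and meets (greatest lower
bounds). -/
def IsCong {V : Type*} (A : Set (V × V)) (r : ARP A → ARP A → Prop) : Prop :=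
  Equivalence r ∧
    (∀ x x' y y' j j' : ARP A,
      r x x' → r y y' → IsLUB {x, y} j → IsLUB {x', y'} j' → r j j') ∧
    (∀ x x' y y' m m' : ARP A,
      r x x' → r y y' → IsGLB {x, y} m → IsGLB {x', y'} m' → r m m')

/-- `r` is a subrope of `r'`. -/
def Subrope {V : Type*} (r r' : RopeData V) : Prop :=
  ({r.u, r.v} : Set V) ⊆ ({r'.u, r'.v} : Set V) ∪ r'.down ∪ r'.up ∧
    r.down ⊆ r'.down ∧ r.up ⊆ r'.up

section helpers

variable {V : Type*}

/-- Reachability. -/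
abbrev Le (A : Set (V × V)) : V → V → Prop := Relation.ReflTransGen (ArcRel A)

/-- The facts about skeletal graphs which the proof uses. -/
structure Sk (A : Set (V × V)) (f : V → ℕ) : Prop where
  lt : ∀ {x y}, (x, y) ∈ A → f x < f y
  cl : ∀ {u v}, (u, v) ∈ A → ∀ {x y}, Le A u x → Le A x v → Le A u y → Le A y v →
    x = y ∨ (x, y) ∈ A ∨ (y, x) ∈ A
  tri : ∀ {B : Set (V × V)}, B ⊆ A →
    (∀ x y z, (x, y) ∈ B → (y, z) ∈ B → (x, z) ∈ A → (x, z) ∈ B) →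
    (∀ x y z, (x, y) ∈ A → (y, z) ∈ A → (x, z) ∈ B → (x, y) ∈ B ∨ (y, z) ∈ B) → ARmem A B

theorem Le.single {A : Set (V × V)} {x y : V} (h : (x, y) ∈ A) : Le A x y :=
  Relation.ReflTransGen.single h

theorem ARmem.closed {A B : Set (V × V)} (h : ARmem A B) {x y z : V} (h1 : (x, y) ∈ B)
    (h2 : (y, z) ∈ B) (h3 : (x, z) ∈ A) : (x, z) ∈ B := by
  by_contra h4
  refine h.2 x (.trans (.single (b := z) ?_) (.trans (.single (b := y) ?_) (.single ?_)))
  · exact Or.inl ⟨h3, h4⟩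
  · exact Or.inr ⟨_, h2, rfl⟩
  · exact Or.inr ⟨_, h1, rfl⟩

theorem ARmem.coclosed {A B : Set (V × V)} (h : ARmem A B) {x y z : V} (h1 : (x, y) ∈ A)
    (h2 : (y, z) ∈ A) (h3 : (x, z) ∈ B) : (x, y) ∈ B ∨ (y, z) ∈ B := by
  by_contra! h4
  refine h.2 x (.trans (.single (b := y) ?_) (.trans (.single (b := z) ?_) (.single ?_)))
  · exact Or.inl ⟨h1, h4.1⟩
  · exact Or.inl ⟨h2, h4.2⟩
  · exact Or.inr ⟨_, h3, rfl⟩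

/-- The set of arcs of the join irreducible attached to the rope `(u, v, D, Dᶜ)`. -/
def KK (A : Set (V × V)) (u v : V) (D : Set V) : Set (V × V) :=
  {a | a ∈ A ∧ Le A u a.1 ∧ Le A a.2 v ∧ (a.1 = u ∨ a.1 ∉ D) ∧ (a.2 = v ∨ a.2 ∈ D)}

theorem mem_KK {A : Set (V × V)} {u v : V} {D : Set V} {x y : V} :
    (x, y) ∈ KK A u v D ↔
      (x, y) ∈ A ∧ Le A u x ∧ Le A y v ∧ (x = u ∨ x ∉ D) ∧ (y = v ∨ y ∈ D) := Iff.rfl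

theorem self_mem_KK {A : Set (V × V)} {u v : V} {D : Set V} (h : (u, v) ∈ A) :
    (u, v) ∈ KK A u v D := ⟨h, .refl, .refl, Or.inl rfl, Or.inl rfl⟩

variable {A : Set (V × V)} {f : V → ℕ}

theorem Sk.le (s : Sk A f) {x y : V} (h : Le A x y) : x = y ∨ f x < f y := by
  induction h with
  | refl => exact Or.inl rfl
  | tail h1 h2 ih =>
    have := s.lt h2
    rcases ih with rfl | h
    · exact Or.inr this
    · exact Or.inr (h.trans this)

theorem Sk.arc (s : Sk A f) {u v x y : V} (h : (u, v) ∈ A) (h1 : Le A u x) (h2 : Le A x y)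
    (h3 : Le A y v) (hn : x ≠ y) : (x, y) ∈ A := by
  rcases s.cl h h1 (h2.trans h3) (h1.trans h2) h3 with h4 | h4 | h4
  · exact absurd h4 hn
  · exact h4
  · have := s.lt h4
    have := s.le h2
    grind

theorem Sk.arc' (s : Sk A f) {u v x y : V} (h : (u, v) ∈ A) (h1 : Le A u x) (h2 : Le A x v)
    (h3 : Le A u y) (h4 : Le A y v) (hn : f x < f y) : (x, y) ∈ A := by
  rcases s.cl h h1 h2 h3 h4 with h4 | h4 | h4
  · subst h4; omega
  · exact h4
  · have := s.lt h4
    omega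

theorem Sk.KK_mem (s : Sk A f) {u v : V} (h : (u, v) ∈ A) (D : Set V) : ARmem A (KK A u v D) := by
  refine s.tri (fun a h => h.1) ?_ ?_
  · intro x y z h1 h2 h3
    rw [mem_KK] at *
    have := s.le h1.2.1
    have := s.le h2.2.2.1
    have := s.lt h1.1
    have := s.lt h2.1
    grind
  · intro x y z h1 h2 h3
    rw [mem_KK] at *
    have g1 := h3.2.1.tail h1
    have g2 := h3.2.2.1.head h2
    by_cases hy : y ∈ D
    · exact Or.inl ⟨h1, h3.2.1, g2, h3.2.2.2.1, Or.inr hy⟩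
    · exact Or.inr ⟨h2, g1, h3.2.2.1, Or.inr hy, h3.2.2.2.2⟩

theorem Sk.KKst_mem (s : Sk A f) {u v : V} (h : (u, v) ∈ A) (D : Set V) :
    ARmem A (KK A u v D \ {(u, v)}) := by
  have hK := s.KK_mem h D
  refine s.tri (fun a h => h.1.1) ?_ ?_
  · intro x y z h1 h2 h3
    have h1 := mem_KK.1 h1.1
    have h2 := mem_KK.1 h2.1
    have := s.le h1.2.1
    have := s.le h2.2.2.1
    have := s.lt h1.1
    have := s.lt h2.1
    grind
  · intro x y z h1 h2 h3
    have h5 := mem_KK.1 h3.1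
    have := s.le h5.2.1
    have := s.le h5.2.2.1
    have := s.lt h1
    have := s.lt h2
    rcases hK.coclosed h1 h2 h3.1 with h4 | h4
    · refine Or.inl ⟨h4, ?_⟩
      simp only [Set.mem_singleton_iff, Prod.mk.injEq]
      grind
    · refine Or.inr ⟨h4, ?_⟩
      simp only [Set.mem_singleton_iff, Prod.mk.injEq]
      grind

theorem Sk.compl_mem (s : Sk A f) {B : Set (V × V)} (h : ARmem A B) : ARmem A (A \ B) := by
  refine s.tri (fun a h => h.1) ?_ ?_
  · intro x y z h1 h2 h3
    refine ⟨h3, fun h4 => ?_⟩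
    rcases h.coclosed h1.1 h2.1 h4 with h5 | h5
    · exact h1.2 h5
    · exact h2.2 h5
  · intro x y z h1 h2 h3
    by_contra! h4
    refine h3.2 (h.closed (y := y) ?_ ?_ h3.1)
    · by_contra h5; exact h4.1 ⟨h1, h5⟩
    · by_contra h5; exact h4.2 ⟨h2, h5⟩

/-- The join. -/
def Cl (A X Y : Set (V × V)) : Set (V × V) :=
  {a | a ∈ A ∧ Relation.TransGen (ArcRel (X ∪ Y)) a.1 a.2}

theorem Sk.Cl_mem (s : Sk A f) {X Y : Set (V × V)} (hX : ARmem A X) (hY : ARmem A Y) :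
    ARmem A (Cl A X Y) := by
  refine s.tri (fun a h => h.1) ?_ ?_
  · intro x y z h1 h2 h3
    exact ⟨h3, h1.2.trans h2.2⟩
  · intro x y z h1 h2 h3
    suffices Relation.TransGen (ArcRel (X ∪ Y)) x y ∨ Relation.TransGen (ArcRel (X ∪ Y)) y z from
      this.imp (fun h => ⟨h1, h⟩) (fun h => ⟨h2, h⟩)
    have hsub : ∀ {a b}, Relation.ReflTransGen (ArcRel (X ∪ Y)) a b → Le A a b := by
      intro a b h
      refine Relation.ReflTransGen.mono ?_ _ _ h
      rintro a b (h | h)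
      · exact hX.1 h
      · exact hY.1 h
    obtain ⟨h3A, h3⟩ := h3
    have key : ∀ p, Relation.ReflTransGen (ArcRel (X ∪ Y)) p z →
        Relation.ReflTransGen (ArcRel (X ∪ Y)) x p → (p = y ∨ (p, y) ∈ A) →
        Relation.TransGen (ArcRel (X ∪ Y)) x y ∨ Relation.TransGen (ArcRel (X ∪ Y)) y z := by
      intro p hp
      induction hp using Relation.ReflTransGen.head_induction_on with
      | refl =>
        intro _ h
        have := s.lt h2
        rcases h with h | h
        · subst h; omega
        · have := s.lt h; omega
      | head hpq hqz ih =>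
        rename_i p q
        intro hxp hpy
        rcases hpy with rfl | hpy
        · exact Or.inr (.head' hpq hqz)
        have hxq := hxp.tail hpq
        rcases s.cl h3A (hsub hxq) (hsub hqz) (Le.single h1) (Le.single h2) with h | h | h
        · exact ih hxq (Or.inl h)
        · exact ih hxq (Or.inr h)
        · have : (p, y) ∈ X ∪ Y ∨ (y, q) ∈ X ∪ Y := by
            rcases hpq with hpq | hpq
            · exact (hX.coclosed hpy h hpq).imp Or.inl Or.inl
            · exact (hY.coclosed hpy h hpq).imp Or.inr Or.inr
          rcases this with h | h
          · exact Or.inl (.tail' hxp h)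
          · exact Or.inr (.head' h hqz)
    exact key x h3.to_reflTransGen .refl (Or.inr h1)

theorem Sk.Cl_lub (s : Sk A f) (X Y : ARP A) :
    IsLUB {X, Y} (⟨Cl A X.1 Y.1, s.Cl_mem X.2 Y.2⟩ : ARP A) := by
  constructor
  · rintro Z (rfl | rfl)
    · exact fun a h => ⟨Z.2.1 h, .single (Or.inl h)⟩
    · exact fun a h => ⟨Z.2.1 h, .single (Or.inr h)⟩
  · intro Z hZ
    have hX : X.1 ⊆ Z.1 := hZ (Or.inl rfl)
    have hY : Y.1 ⊆ Z.1 := hZ (Or.inr rfl)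
    rintro ⟨x, y⟩ ⟨hA, h⟩
    have hsub : ∀ {a b}, Relation.ReflTransGen (ArcRel (X.1 ∪ Y.1)) a b → Le A a b := by
      intro a b h
      refine Relation.ReflTransGen.mono ?_ _ _ h
      rintro a b (h | h)
      · exact X.2.1 h
      · exact Y.2.1 h
    have key : ∀ p, Relation.TransGen (ArcRel (X.1 ∪ Y.1)) x p → Le A p y → (x, p) ∈ Z.1 := by
      intro p hp
      induction hp with
      | single h => exact fun _ => h.elim (@hX _) (@hY _)
      | tail hxp hpq ih =>
        rename_i p q
        intro hqy
        have hpqZ : (p, q) ∈ Z.1 := hpq.elim (@hX _) (@hY _)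
        have h1 := ih (hqy.head (Z.2.1 hpqZ))
        have := s.lt (Z.2.1 h1)
        have := s.lt (Z.2.1 hpqZ)
        refine Z.2.closed h1 hpqZ (s.arc hA .refl (hsub (hxp.tail hpq).to_reflTransGen) hqy ?_)
        rintro rfl; omega
    exact key y h .refl

theorem exists_step {R : V → V → Prop} (P : V → Prop) {u v : V} (h : Relation.ReflTransGen R u v)
    (hu : P u) (hv : ¬ P v) : ∃ z w, Relation.ReflTransGen R u z ∧ R z w ∧
      Relation.ReflTransGen R w v ∧ P z ∧ ¬ P w := by
  induction h with
  | refl => exact absurd hu hv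
  | tail hup hpq ih =>
    rename_i p q
    by_cases hp : P p
    · exact ⟨p, q, hup, hpq, .refl, hp, hv⟩
    · obtain ⟨z, w, h1, h2, h3, h4, h5⟩ := ih hp
      exact ⟨z, w, h1, h2, h3.tail hpq, h4, h5⟩

theorem Sk.min_step (s : Sk A f) {u v z w : V} {D : Set V} {X : Set (V × V)} (hX : ARmem A X)
    (huv : (u, v) ∈ A) (huz : Le A u z) (hwv : Le A w v) (hzw : (z, w) ∈ X)
    (hz : z = u ∨ z ∈ D) (hw : w = v ∨ w ∉ D)
    (hmin : ∀ z' w', (z', w') ∈ X → Le A u z' → Le A w' v → (z' = u ∨ z' ∈ D) →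
      (w' = v ∨ w' ∉ D) → f w - f z ≤ f w' - f z') : KK A z w D ⊆ X := by
  have hzwA := hX.1 hzw
  have hzv : Le A z v := hwv.head hzwA
  have huw : Le A u w := huz.tail hzwA
  have hlt := s.lt hzwA
  -- arcs from `z` to an upper vertex are not in `X`
  have c1 : ∀ x, (z, x) ∈ A → (x, w) ∈ A → x ∉ D → (z, x) ∉ X := by
    intro x h1 h2 h3 h4
    have := hmin z x h4 huz (hwv.head h2) hz (Or.inr h3)
    have := s.lt h1
    have := s.lt h2
    omega
  have c2 : ∀ y, (z, y) ∈ A → (y, w) ∈ A → y ∈ D → (y, w) ∉ X := by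
    intro x h1 h2 h3 h4
    have := hmin x w h4 (huz.tail h1) hwv (Or.inr h3) hw
    have := s.lt h1
    have := s.lt h2
    omega
  have d2 : ∀ y, (z, y) ∈ A → (y, w) ∈ A → y ∈ D → (z, y) ∈ X := fun y h1 h2 h3 =>
    (hX.coclosed h1 h2 hzw).resolve_right (c2 y h1 h2 h3)
  rintro ⟨x, y⟩ h
  obtain ⟨hxy, hzx, hyw, hx, hy⟩ := mem_KK.1 h
  by_cases hxz : x = z
  · subst hxz
    by_cases hyw' : y = w
    · subst hyw'; exact hzw
    · exact d2 y hxy (s.arc hzwA (Le.single hxy) hyw .refl hyw') (hy.resolve_left hyw')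
  · have hx' := hx.resolve_left hxz
    have hzxA : (z, x) ∈ A := s.arc hzwA .refl hzx (hyw.head hxy) (Ne.symm hxz)
    have hxwA : (x, w) ∈ A := by
      refine s.arc hzwA hzx (hyw.head hxy) .refl ?_
      rintro rfl
      have := s.le hyw
      have := s.lt hxy
      grind
    by_cases hyw' : y = w
    · subst hyw'
      exact (hX.coclosed hzxA hxy hzw).resolve_left (c1 x hzxA hxy hx')
    · have hywA := s.arc hzwA (hzx.tail hxy) hyw .refl hyw'
      have hzyA : (z, y) ∈ A := by
        refine s.arc hzwA .refl (hzx.tail hxy) hyw ?_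
        rintro rfl
        have := s.lt hxy
        have := s.lt hzxA
        omega
      exact (hX.coclosed hzxA hxy (d2 y hzyA hywA (hy.resolve_left hyw'))).resolve_left
        (c1 x hzxA hxwA hx')

theorem Sk.join_aux (s : Sk A f) {X Y W : Set (V × V)} (hX : ARmem A X) (hY : ARmem A Y)
    (hW : ARmem A W) (D : Set V) (n : ℕ) : ∀ u v, f v - f u ≤ n → (u, v) ∈ A →
      KK A u v D ⊆ Cl A X Y →
      (∀ z w, Le A u z → Le A w v → (z, w) ∈ A → KK A z w D ⊆ X → (z, w) ∈ W) →
      (∀ z w, Le A u z → Le A w v → (z, w) ∈ A → KK A z w D ⊆ Y → (z, w) ∈ W) →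
      (u, v) ∈ W := by
  induction n with
  | zero =>
    intro u v h h1
    have := s.lt h1
    omega
  | succ n ih =>
    intro u v hn huv hK hWX hWY
    have hsub : ∀ {a b}, Relation.ReflTransGen (ArcRel (X ∪ Y)) a b → Le A a b := by
      intro a b h
      refine Relation.ReflTransGen.mono ?_ _ _ h
      rintro a b (h | h)
      · exact hX.1 h
      · exact hY.1 h
    let P : ℕ → Prop := fun k => ∃ z w, (z, w) ∈ X ∪ Y ∧ Le A u z ∧ Le A w v ∧ (z = u ∨ z ∈ D) ∧
      (w = v ∨ w ∉ D) ∧ f w - f z = k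
    have hP : ∃ k, P k := by
      have huv' := s.lt huv
      obtain ⟨z, w, h1, h2, h3, h4, h5⟩ := exists_step (fun z => z ≠ v ∧ (z = u ∨ z ∈ D))
        (hK (self_mem_KK huv)).2.to_reflTransGen ⟨fun h => (by rw [show u = v from h] at huv'; omega), Or.inl rfl⟩ (by simp)
      refine ⟨_, z, w, h2, hsub h1, hsub h3, h4.2, ?_, rfl⟩
      by_contra! h
      exact h5 ⟨h.1, Or.inr h.2⟩
    classical
    obtain ⟨z, w, hzw, huz, hwv, hz, hw, hk⟩ := Nat.find_spec hP
    have hmin : ∀ z' w', (z', w') ∈ X ∪ Y → Le A u z' → Le A w' v → (z' = u ∨ z' ∈ D) →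
      (w' = v ∨ w' ∉ D) → f w - f z ≤ f w' - f z' := by
      intro z' w' h1 h2 h3 h4 h5
      rw [hk]
      exact Nat.find_min' hP ⟨z', w', h1, h2, h3, h4, h5, rfl⟩
    have hzwA : (z, w) ∈ A := hzw.elim (@hX.1 _) (@hY.1 _)
    have hzwW : (z, w) ∈ W := by
      rcases hzw with h | h
      · exact hWX z w huz hwv hzwA (s.min_step hX huv huz hwv h hz hw
          fun z' w' h => hmin z' w' (Or.inl h))
      · exact hWY z w huz hwv hzwA (s.min_step hY huv huz hwv h hz hw
          fun z' w' h => hmin z' w' (Or.inr h))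
    have l1 := s.lt hzwA
    have l2 := s.le huz
    have l3 := s.le hwv
    have l4 := s.lt huv
    have huwW : (u, w) ∈ W := by
      rcases eq_or_ne z u with rfl | hne
      · exact hzwW
      · have huzA : (u, z) ∈ A := s.arc huv .refl huz (hwv.head hzwA) hne.symm
        have hzD := hz.resolve_left hne
        have hzv : Le A z v := hwv.head hzwA
        refine hW.closed (y := z) ?_ hzwW (s.arc huv .refl (huz.tail hzwA) hwv (by grind))
        refine ih u z (by grind) huzA ?_ ?_ ?_
        · refine subset_trans ?_ hK
          rintro ⟨x, y⟩ h
          obtain ⟨h1, h2, h3, h4, h5⟩ := mem_KK.1 h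
          exact mem_KK.2 ⟨h1, h2, h3.trans hzv, h4, Or.inr (h5.elim (fun h => h ▸ hzD) id)⟩
        · exact fun z' w' h1 h2 => hWX z' w' h1 (h2.trans hzv)
        · exact fun z' w' h1 h2 => hWY z' w' h1 (h2.trans hzv)
    rcases eq_or_ne w v with rfl | hne
    · exact huwW
    · have hwvA : (w, v) ∈ A := s.arc huv (huz.tail hzwA) hwv .refl hne
      have hwD := hw.resolve_left hne
      have huw : Le A u w := huz.tail hzwA
      refine hW.closed (y := w) huwW ?_ huv
      refine ih w v (by grind) hwvA ?_ ?_ ?_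
      · refine subset_trans ?_ hK
        rintro ⟨x, y⟩ h
        obtain ⟨h1, h2, h3, h4, h5⟩ := mem_KK.1 h
        exact mem_KK.2 ⟨h1, huw.trans h2, h3, Or.inr (h4.elim (fun h => h ▸ hwD) id), h5⟩
      · exact fun z' w' h1 h2 => hWX z' w' (huw.trans h1) h2
      · exact fun z' w' h1 h2 => hWY z' w' (huw.trans h1) h2

/-- Subrope relation, with ropes encoded as `(u, v, D)`. -/
def SubR (A : Set (V × V)) (u v : V) (D : Set V) (u' v' : V) (D' : Set V) : Prop :=
  Le A u' u ∧ Le A v v' ∧ ∀ w, (u, w) ∈ A → (w, v) ∈ A → (w ∈ D ↔ w ∈ D')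

theorem SubR.left {A : Set (V × V)} {u v u' v' : V} {D D' : Set V}
    (h : SubR A u v D u' v' D') : Le A u' u := by
  obtain ⟨h1, -, -⟩ := h
  exact h1

/-- The congruence contracting exactly the superropes of `(u, v, D)`. -/
def rcon (A : Set (V × V)) (u v : V) (D : Set V) (X Y : ARP A) : Prop :=
  ∀ u' v' D', (u', v') ∈ A → ¬ SubR A u v D u' v' D' → (KK A u' v' D' ⊆ X.1 ↔ KK A u' v' D' ⊆ Y.1)

theorem KK_mono {u v x y : V} {D : Set V} (h : (x, y) ∈ KK A u v D) :
    KK A x y D ⊆ KK A u v D := by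
  obtain ⟨h1, h2, h3, h4, h5⟩ := mem_KK.1 h
  rintro ⟨p, q⟩ h'
  obtain ⟨g1, g2, g3, g4, g5⟩ := mem_KK.1 h'
  refine mem_KK.2 ⟨g1, h2.trans g2, g3.trans h3, ?_, ?_⟩
  · rcases g4 with rfl | g4
    · exact h4
    · exact Or.inr g4
  · rcases g5 with rfl | g5
    · exact h5
    · exact Or.inr g5

theorem Sk.rcon_cong (s : Sk A f) (u v : V) (D : Set V) : IsCong A (rcon A u v D) := by
  refine ⟨⟨fun X u' v' D' _ _ => Iff.rfl, fun h u' v' D' h1 h2 => (h u' v' D' h1 h2).symm,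
    fun h g u' v' D' h1 h2 => (h u' v' D' h1 h2).trans (g u' v' D' h1 h2)⟩, ?_, ?_⟩
  · have key : ∀ x x' y y' j j' : ARP A, rcon A u v D x x' → rcon A u v D y y' →
        IsLUB {x, y} j → IsLUB {x', y'} j' → ∀ u' v' D', (u', v') ∈ A →
        ¬ SubR A u v D u' v' D' → KK A u' v' D' ⊆ j.1 → KK A u' v' D' ⊆ j'.1 := by
      intro X X' Y Y' j j' hX hY hj hj' u' v' D' hA hS hK
      have hjC : j.1 ⊆ Cl A X.1 Y.1 := by
        have := hj.2 (s.Cl_lub X Y).1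
        exact this
      have hX' : X'.1 ⊆ j'.1 := hj'.1 (Or.inl rfl)
      have hY' : Y'.1 ⊆ j'.1 := hj'.1 (Or.inr rfl)
      rintro ⟨x, y⟩ hxy
      have hxy' := mem_KK.1 hxy
      have hns : ∀ z w, Le A x z → Le A w y → ¬ SubR A u v D z w D' := by
        intro z w h1 h2 h3
        exact hS ⟨(hxy'.2.1.trans h1).trans h3.1, h3.2.1.trans (h2.trans hxy'.2.2.1), h3.2.2⟩
      refine s.join_aux X.2 Y.2 j'.2 D' _ x y le_rfl hxy'.1
        (((KK_mono hxy).trans hK).trans hjC) ?_ ?_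
      · intro z w h1 h2 h3 h4
        exact hX' ((hX z w D' h3 (hns z w h1 h2)).1 h4 (self_mem_KK h3))
      · intro z w h1 h2 h3 h4
        exact hY' ((hY z w D' h3 (hns z w h1 h2)).1 h4 (self_mem_KK h3))
    intro x x' y y' j j' hx hy hj hj' u' v' D' hA hS
    exact ⟨key x x' y y' j j' hx hy hj hj' u' v' D' hA hS,
      key x' x y' y j' j (fun u' v' D' h1 h2 => (hx u' v' D' h1 h2).symm)
        (fun u' v' D' h1 h2 => (hy u' v' D' h1 h2).symm) hj' hj u' v' D' hA hS⟩
  · have key : ∀ x y m : ARP A, IsGLB {x, y} m → ∀ u' v' D', (u', v') ∈ A →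
        (KK A u' v' D' ⊆ m.1 ↔ KK A u' v' D' ⊆ x.1 ∧ KK A u' v' D' ⊆ y.1) := by
      intro x y m hm u' v' D' hA
      have h1 : m.1 ⊆ x.1 := hm.1 (Or.inl rfl)
      have h2 : m.1 ⊆ y.1 := hm.1 (Or.inr rfl)
      refine ⟨fun h => ⟨h.trans h1, h.trans h2⟩, fun h => ?_⟩
      have : (⟨KK A u' v' D', s.KK_mem hA D'⟩ : ARP A) ≤ m := by
        refine hm.2 ?_
        rintro Z (rfl | rfl)
        · exact h.1
        · exact h.2
      exact this
    intro x x' y y' m m' hx hy hm hm' u' v' D' hA hS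
    rw [key x y m hm u' v' D' hA, key x' y' m' hm' u' v' D' hA, hx u' v' D' hA hS,
      hy u' v' D' hA hS]

def Sk.K (s : Sk A f) {u v : V} (h : (u, v) ∈ A) (D : Set V) : ARP A := ⟨_, s.KK_mem h D⟩

/-- The element covered by the join irreducible. -/
def Sk.Kst (s : Sk A f) {u v : V} (h : (u, v) ∈ A) (D : Set V) : ARP A := ⟨_, s.KKst_mem h D⟩

/-- Complement. -/
def Sk.co (s : Sk A f) (X : ARP A) : ARP A := ⟨_, s.compl_mem X.2⟩

theorem Sk.co_co (s : Sk A f) (X : ARP A) : s.co (s.co X) = X := by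
  apply Subtype.ext
  change A \ (A \ X.1) = X.1
  rw [Set.sdiff_sdiff_right_self, Set.inter_eq_right]
  exact X.2.1

theorem Sk.co_le (s : Sk A f) {X Y : ARP A} (h : X ≤ Y) : s.co Y ≤ s.co X :=
  fun _ ha => ⟨ha.1, fun hb => ha.2 (h hb)⟩

theorem Sk.co_lub (s : Sk A f) {X Y j : ARP A} (h : IsLUB {X, Y} j) :
    IsGLB {s.co X, s.co Y} (s.co j) := by
  constructor
  · rintro Z (rfl | rfl)
    · exact s.co_le (h.1 (Or.inl rfl))
    · exact s.co_le (h.1 (Or.inr rfl))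
  · intro Z hZ
    rw [← s.co_co Z]
    refine s.co_le (h.2 ?_)
    rintro T (rfl | rfl)
    · rw [← s.co_co T]; exact s.co_le (hZ (Or.inl rfl))
    · rw [← s.co_co T]; exact s.co_le (hZ (Or.inr rfl))

theorem Sk.co_glb (s : Sk A f) {X Y j : ARP A} (h : IsGLB {X, Y} j) :
    IsLUB {s.co X, s.co Y} (s.co j) := by
  constructor
  · rintro Z (rfl | rfl)
    · exact s.co_le (h.1 (Or.inl rfl))
    · exact s.co_le (h.1 (Or.inr rfl))
  · intro Z hZ
    rw [← s.co_co Z]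
    refine s.co_le (h.2 ?_)
    rintro T (rfl | rfl)
    · rw [← s.co_co T]; exact s.co_le (hZ (Or.inl rfl))
    · rw [← s.co_co T]; exact s.co_le (hZ (Or.inr rfl))

theorem Sk.dual_cong (s : Sk A f) {r : ARP A → ARP A → Prop} (h : IsCong A r) :
    IsCong A (fun X Y => r (s.co X) (s.co Y)) := by
  refine ⟨⟨fun X => h.1.refl _, fun h' => h.1.symm h', fun h' h'' => h.1.trans h' h''⟩, ?_, ?_⟩
  · intro x x' y y' j j' hx hy hj hj'
    exact h.2.2 _ _ _ _ _ _ hx hy (s.co_lub hj) (s.co_lub hj')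
  · intro x x' y y' j j' hx hy hj hj'
    have hm := s.co_glb hj'
    exact h.2.1 _ _ _ _ _ _ hx hy (s.co_glb hj) hm

/-- `r` contracts the rope `(u, v, D)`. -/
def Sk.C (s : Sk A f) (r : ARP A → ARP A → Prop) {u v : V} (h : (u, v) ∈ A) (D : Set V) : Prop :=
  r (s.K h D) (s.Kst h D)

theorem Sk.disj (s : Sk A f) {u v u' v' : V} {D : Set V} (h1 : Le A u' u)
    (h2 : Le A v v') {x y : V} (h : (x, y) ∈ KK A u v D) (hne : (x, y) ≠ (u, v)) :
    (x, y) ∉ KK A u' v' Dᶜ := by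
  intro h'
  obtain ⟨g1, g2, g3, g4, g5⟩ := mem_KK.1 h
  obtain ⟨k1, k2, k3, k4, k5⟩ := mem_KK.1 h'
  have := s.le h1
  have := s.le h2
  have := s.le g2
  have := s.le g3
  have hx : x = u := by
    rcases g4 with h | h
    · exact h
    · rcases k4 with rfl | h'
      · grind
      · exact absurd h (by simpa using h')
  have hy : y = v := by
    rcases g5 with h | h
    · exact h
    · rcases k5 with rfl | h'
      · grind
      · exact absurd h h'
  exact hne (by rw [hx, hy])

theorem Sk.C_dual (s : Sk A f) {r : ARP A → ARP A → Prop} (hr : IsCong A r) {u v : V}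
    (h : (u, v) ∈ A) {D : Set V} (hC : s.C r h D) :
    s.C (fun X Y => r (s.co X) (s.co Y)) h Dᶜ := by
  refine hr.1.symm (hr.2.1 _ _ _ _ _ _ hC (hr.1.refl (s.co (s.K h Dᶜ))) ?_ ?_)
  · constructor
    · rintro Z (rfl | rfl)
      · rintro ⟨x, y⟩ hxy
        refine ⟨hxy.1, fun h' => ?_⟩
        exact s.disj .refl .refl hxy h'.2 h'.1
      · exact s.co_le Set.sdiff_subset
    · intro Z hZ
      have h1 : (s.K h D).1 ⊆ Z.1 := hZ (Or.inl rfl)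
      have h2 : (s.co (s.K h Dᶜ)).1 ⊆ Z.1 := hZ (Or.inr rfl)
      rintro ⟨x, y⟩ hxy
      by_cases he : (x, y) = (u, v)
      · rw [he]; exact h1 (self_mem_KK h)
      · exact h2 ⟨hxy.1, fun h' => hxy.2 ⟨h', he⟩⟩
  · constructor
    · rintro Z (rfl | rfl)
      · rintro ⟨x, y⟩ hxy
        exact ⟨hxy.1.1, s.disj .refl .refl hxy.1 hxy.2⟩
      · exact le_rfl
    · intro Z hZ
      exact hZ (Or.inr rfl)

theorem Sk.C_stepJ (s : Sk A f) {r : ARP A → ARP A → Prop} (hr : IsCong A r) {u v u' v' : V}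
    (h : (u, v) ∈ A) (h' : (u', v') ∈ A) {D : Set V} (hu : Le A u' u) (hv : Le A v v')
    (hu' : u = u' ∨ u ∈ D) (hv' : v = v' ∨ v ∉ D) (hC : s.C r h D) : s.C r h' D := by
  have hj := s.Cl_lub (s.K h D) (s.Kst h' D)
  have hk := s.Cl_lub (s.Kst h D) (s.Kst h' D)
  have hjk := hr.2.1 _ _ _ _ _ _ hC (hr.1.refl (s.Kst h' D)) hj hk
  generalize (⟨_, _⟩ : ARP A) = j at hj hjk
  generalize (⟨_, _⟩ : ARP A) = k at hk hjk
  refine hr.2.2 _ _ _ _ _ _ hjk (hr.1.refl (s.K h' D)) ?_ ?_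
  · have h1 : (s.K h D).1 ⊆ j.1 := hj.1 (Or.inl rfl)
    have h2 : (s.Kst h' D).1 ⊆ j.1 := hj.1 (Or.inr rfl)
    have l1 := s.le hu
    have l2 := s.le hv
    have l3 := s.lt h
    have l4 := s.lt h'
    have huvj : (u, v) ∈ j.1 := h1 (self_mem_KK h)
    have hu'v : (u', v) ∈ j.1 := by
      rcases eq_or_ne u u' with rfl | hne
      · exact huvj
      · refine j.2.closed (y := u) ?_ huvj (s.arc h' .refl (hu.tail h) hv (by grind))
        refine h2 ⟨mem_KK.2 ⟨s.arc h' .refl hu (hv.head h) hne.symm, .refl, hv.head h, Or.inl rfl,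
          Or.inr (hu'.resolve_left hne)⟩, ?_⟩
        simp only [Set.mem_singleton_iff, Prod.mk.injEq]
        grind
    have huv' : (u', v') ∈ j.1 := by
      rcases eq_or_ne v v' with rfl | hne
      · exact hu'v
      · refine j.2.closed (y := v) hu'v ?_ h'
        refine h2 ⟨mem_KK.2 ⟨s.arc h' (hu.tail h) hv .refl hne, hu.tail h, .refl,
          Or.inr (hv'.resolve_left hne), Or.inl rfl⟩, ?_⟩
        simp only [Set.mem_singleton_iff, Prod.mk.injEq]
        grind
    constructor
    · rintro Z (rfl | rfl)
      · intro a ha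
        by_cases he : a = (u', v')
        · rw [he]; exact huv'
        · exact h2 ⟨ha, he⟩
      · exact le_rfl
    · intro Z hZ
      exact hZ (Or.inr rfl)
  · have hkM : k ≤ s.co (s.K h' Dᶜ) := by
      refine hk.2 ?_
      rintro Z (rfl | rfl)
      · rintro ⟨x, y⟩ hxy
        exact ⟨hxy.1.1, s.disj hu hv hxy.1 hxy.2⟩
      · rintro ⟨x, y⟩ hxy
        exact ⟨hxy.1.1, s.disj .refl .refl hxy.1 hxy.2⟩
    constructor
    · rintro Z (rfl | rfl)
      · exact hk.1 (Or.inr rfl)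
      · exact Set.sdiff_subset
    · intro Z hZ
      have h1 : Z.1 ⊆ k.1 := hZ (Or.inl rfl)
      have h2 : Z.1 ⊆ (s.K h' D).1 := hZ (Or.inr rfl)
      intro a ha
      refine ⟨h2 ha, ?_⟩
      rintro rfl
      exact (hkM (h1 ha)).2 (self_mem_KK h')

theorem Sk.C_stepM (s : Sk A f) {r : ARP A → ARP A → Prop} (hr : IsCong A r) {u v u' v' : V}
    (h : (u, v) ∈ A) (h' : (u', v') ∈ A) {D : Set V} (hu : Le A u' u) (hv : Le A v v')
    (hu' : u = u' ∨ u ∉ D) (hv' : v = v' ∨ v ∈ D) (hC : s.C r h D) : s.C r h' D := by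
  have h1 := s.C_stepJ (s.dual_cong hr) h h' hu hv hu' (by simpa using hv') (s.C_dual hr h hC)
  have h2 := s.C_dual (s.dual_cong hr) h' h1
  simpa only [s.co_co, compl_compl] using h2

theorem Sk.C_step (s : Sk A f) {r : ARP A → ARP A → Prop} (hr : IsCong A r) {u v u' v' : V}
    (h : (u, v) ∈ A) (h' : (u', v') ∈ A) {D : Set V} (hu : Le A u' u) (hv : Le A v v')
    (hC : s.C r h D) : s.C r h' D := by
  have l1 := s.lt h
  have l2 := s.le hv
  have h'' : (u, v') ∈ A := s.arc h' hu (hv.head h) .refl (by grind)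
  have hC' : s.C r h'' D := by
    by_cases hD : v ∈ D
    · exact s.C_stepM hr h h'' .refl hv (Or.inl rfl) (Or.inr hD) hC
    · exact s.C_stepJ hr h h'' .refl hv (Or.inl rfl) (Or.inr hD) hC
  by_cases hD : u ∈ D
  · exact s.C_stepJ hr h'' h' hu .refl (Or.inr hD) (Or.inl rfl) hC'
  · exact s.C_stepM hr h'' h' hu .refl (Or.inr hD) (Or.inl rfl) hC'

theorem Sk.KK_congr (s : Sk A f) {u v : V} (h : (u, v) ∈ A) {D D' : Set V}
    (hD : ∀ w, (u, w) ∈ A → (w, v) ∈ A → (w ∈ D ↔ w ∈ D')) : KK A u v D = KK A u v D' := by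
  ext ⟨x, y⟩
  rw [mem_KK, mem_KK]
  refine and_congr_right fun h1 => and_congr_right fun h2 => and_congr_right fun h3 => ?_
  have l1 := s.lt h1
  have l2 := s.le h2
  have l3 := s.le h3
  refine and_congr (or_congr_right' fun hn => ?_) (or_congr_right' fun hn => ?_)
  · rw [hD x (s.arc h .refl h2 (h3.head h1) (Ne.symm hn)) (s.arc h h2 (h3.head h1) .refl (by grind))]
  · rw [hD y (s.arc h .refl (h2.tail h1) h3 (by grind)) (s.arc h (h2.tail h1) h3 .refl hn)]

end helpers
section skeletal

variable {V : Type*}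

theorem exists_rank [Fintype V] {A : Set (V × V)} (hA : AcyclicArcs A) :
    ∃ f : V → ℕ, ∀ {x y}, (x, y) ∈ A → f x < f y := by
  refine ⟨fun x => Set.ncard {z | Relation.TransGen (ArcRel A) z x}, fun {x y} h => ?_⟩
  refine Set.ncard_lt_ncard ?_ (Set.toFinite _)
  refine ⟨fun z hz => Relation.TransGen.tail hz h, fun h' => ?_⟩
  exact hA x (h' (show x ∈ {z | Relation.TransGen (ArcRel A) z y} from .single h))

theorem vrank_le {A : Set (V × V)} {f : V → ℕ} (hf : ∀ {x y}, (x, y) ∈ A → f x < f y)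
    {x y : V} (h : Le A x y) : x = y ∨ f x < f y := by
  induction h with
  | refl => exact Or.inl rfl
  | tail h1 h2 ih =>
    have := hf h2
    rcases ih with rfl | h
    · exact Or.inr this
    · exact Or.inr (h.trans this)

theorem exists_list {A : Set (V × V)} {w v : V} (h : Le A w v) : ∃ p : List V,
    p.Chain' (fun x y => (x, y) ∈ A) ∧ p.head? = some w ∧ p.getLast? = some v := by
  induction h using Relation.ReflTransGen.head_induction_on with
  | refl => exact ⟨[v], by simp [List.Chain'], rfl, rfl⟩
  | head h1 h2 ih =>
    rename_i a b
    obtain ⟨p, hp, h3, h4⟩ := ih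
    cases p with
    | nil => simp at h3
    | cons c p =>
      simp at h3
      subst h3
      exact ⟨a :: c :: p, by simpa [List.Chain'] using ⟨h1, hp⟩, rfl, by simpa using h4⟩

theorem exists_list' {A : Set (V × V)} {u w v : V} (h0 : Le A u w) (h : Le A w v) :
    ∃ p : List V, p.Chain' (fun x y => (x, y) ∈ A) ∧ p.head? = some u ∧ p.getLast? = some v ∧
      w ∈ p := by
  induction h0 using Relation.ReflTransGen.head_induction_on with
  | refl =>
    obtain ⟨p, h1, h2, h3⟩ := exists_list h
    exact ⟨p, h1, h2, h3, List.mem_of_mem_head? (by simp [h2])⟩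
  | head h1 h2 ih =>
    rename_i a b
    obtain ⟨p, hp, h3, h4, h5⟩ := ih
    cases p with
    | nil => simp at h3
    | cons c p =>
      simp at h3
      subst h3
      exact ⟨a :: c :: p, by simpa [List.Chain'] using ⟨h1, hp⟩, rfl, by simpa using h4,
        List.mem_cons_of_mem _ h5⟩

theorem fill {A : Set (V × V)} {f : V → ℕ} (hf : ∀ {x y}, (x, y) ∈ A → f x < f y)
    (hF : Filled A) {u v w : V} (huv : (u, v) ∈ A) (h1 : Le A u w) (h2 : Le A w v) :
    w = u ∨ w = v ∨ ((u, w) ∈ A ∧ (w, v) ∈ A) := by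
  obtain ⟨p, hp, h3, h4, h5⟩ := exists_list' h1 h2
  have hu : u ∈ p := List.mem_of_mem_head? (by simp [h3])
  have hv : v ∈ p := List.mem_of_mem_getLast? (by simp [h4])
  by_cases e1 : w = u
  · exact Or.inl e1
  by_cases e2 : w = v
  · exact Or.inr (Or.inl e2)
  refine Or.inr (Or.inr ⟨?_, ?_⟩)
  · rcases hF p hp u v h3 h4 huv u hu w h5 (Ne.symm e1) with h | h
    · exact h
    · have := hf h
      have := (vrank_le hf h1).resolve_left (Ne.symm e1)
      omega
  · rcases hF p hp u v h3 h4 huv w h5 v hv e2 with h | h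
    · exact h
    · have := hf h
      have := (vrank_le hf h2).resolve_left e2
      omega

theorem not_bridge {G : SimpleGraph V} (hG : G.IsAcyclic) {a b : V} (hab : G.Adj a b)
    (h : (G.deleteEdges {s(a, b)}).Reachable a b) : False := by
  have := SimpleGraph.isAcyclic_iff_forall_edge_isBridge.1 hG (e := s(a, b)) hab
  rw [SimpleGraph.isBridge_iff] at this
  exact this h

theorem transRed_induced {A : Set (V × V)} {f : V → ℕ} (hf : ∀ {x y}, (x, y) ∈ A → f x < f y)
    (hF : Filled A) {U : Set V} {x y : V} (hxy : (x, y) ∈ A) (hx : x ∈ U) (hy : y ∈ U)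
    (h : ∀ w ∈ U, (x, w) ∈ A → (w, y) ∈ A → False) : (x, y) ∈ transRed (inducedArcs A U) := by
  refine ⟨⟨hxy, hx, hy⟩, ?_⟩
  rintro ⟨w, h1, h2⟩
  have h3 : Le A w y := Relation.ReflTransGen.mono (fun a b h => h.1) _ _ h2.to_reflTransGen
  have hxw : f x < f w := hf h1.1
  have hwy : w ≠ y := by
    rintro rfl
    obtain ⟨z, h4, h5⟩ := Relation.TransGen.head'_iff.1 h2
    have := vrank_le hf (Relation.ReflTransGen.mono (fun a b (h : ArcRel (inducedArcs A U) a b) =>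
      (show ArcRel A a b from h.1)) _ _ h5)
    have := hf h4.1
    grind
  rcases fill hf hF hxy (Le.single h1.1) h3 with h4 | h4 | h4
  · subst h4; omega
  · exact hwy h4
  · exact h w h1.2.2 h4.1 h4.2

theorem clique4 {A : Set (V × V)} {f : V → ℕ} (hf : ∀ {x y}, (x, y) ∈ A → f x < f y)
    (hF : Filled A) (hV : Vertebrate A) {u v x y : V} (hux : (u, x) ∈ A)
    (hxv : (x, v) ∈ A) (huy : (u, y) ∈ A) (hyv : (y, v) ∈ A) :
    x = y ∨ (x, y) ∈ A ∨ (y, x) ∈ A := by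
  by_contra! hn
  obtain ⟨n1, n2, n3⟩ := hn
  have l1 := hf hux
  have l2 := hf hxv
  have l3 := hf huy
  have l4 := hf hyv
  have hU := hV {u, v, x, y}
  have m : ∀ w ∈ ({u, v, x, y} : Set V), w = u ∨ w = v ∨ w = x ∨ w = y := by
    intro w hw; simpa using hw
  have r : ∀ a b, (a, b) ∈ A → a ∈ ({u, v, x, y} : Set V) → b ∈ ({u, v, x, y} : Set V) →
      (∀ w ∈ ({u, v, x, y} : Set V), (a, w) ∈ A → (w, b) ∈ A → False) → a ≠ b →
      (undirectedGraph (transRed (inducedArcs A {u, v, x, y}))).Adj a b := by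
    intro a b h1 h2 h3 h4 h5
    rw [undirectedGraph, SimpleGraph.fromRel_adj]
    exact ⟨h5, Or.inl (transRed_induced hf hF h1 h2 h3 h4)⟩
  have aux : ∀ a b w, (a, b) ∈ A → (b, w) ∈ A → (w, a) ∈ A → False := by
    intro a b w h1 h2 h3
    have := hf h1
    have := hf h2
    have := hf h3
    omega
  have irr : ∀ a, (a, a) ∉ A := fun a h => lt_irrefl _ (hf h)
  have asy : ∀ a b, (a, b) ∈ A → (b, a) ∉ A := fun a b h h' => lt_asymm (hf h) (hf h')
  have e1 := r u x hux (by simp) (by simp) (by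
    intro w hw h1 h2
    rcases m w hw with rfl | rfl | rfl | rfl
    · exact irr _ h1
    · exact asy _ _ hxv h2
    · exact irr _ h2
    · exact n3 h2) (by rintro rfl; omega)
  have e2 := r x v hxv (by simp) (by simp) (by
    intro w hw h1 h2
    rcases m w hw with rfl | rfl | rfl | rfl
    · exact asy _ _ hux h1
    · exact irr _ h2
    · exact irr _ h1
    · exact n2 h1) (by rintro rfl; omega)
  have e3 := r u y huy (by simp) (by simp) (by
    intro w hw h1 h2
    rcases m w hw with rfl | rfl | rfl | rfl
    · exact irr _ h1
    · exact asy _ _ hyv h2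
    · exact n2 h2
    · exact irr _ h2) (by rintro rfl; omega)
  have e4 := r y v hyv (by simp) (by simp) (by
    intro w hw h1 h2
    rcases m w hw with rfl | rfl | rfl | rfl
    · exact asy _ _ huy h1
    · exact irr _ h2
    · exact n3 h1
    · exact irr _ h1) (by rintro rfl; omega)
  have nux : u ≠ x := by rintro rfl; omega
  have nvx : v ≠ x := by rintro rfl; omega
  have nuy : u ≠ y := by rintro rfl; omega
  have nuv : u ≠ v := by rintro rfl; omega
  refine not_bridge hU e1 ?_
  refine SimpleGraph.Reachable.trans (v := y) (SimpleGraph.Adj.reachable ?_)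
    (SimpleGraph.Reachable.trans (v := v) (SimpleGraph.Adj.reachable ?_)
    (SimpleGraph.Adj.reachable ?_))
  · rw [SimpleGraph.deleteEdges_adj]
    refine ⟨e3, ?_⟩
    simp only [Set.mem_singleton_iff, Sym2.eq_iff]
    grind
  · rw [SimpleGraph.deleteEdges_adj]
    refine ⟨e4, ?_⟩
    simp only [Set.mem_singleton_iff, Sym2.eq_iff]
    grind
  · rw [SimpleGraph.deleteEdges_adj]
    refine ⟨e2.symm, ?_⟩
    simp only [Set.mem_singleton_iff, Sym2.eq_iff]
    grind

/-- Walks of given length. -/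
def WalkN (R : V → V → Prop) (n : ℕ) (x y : V) : Prop :=
  ∃ g : ℕ → V, g 0 = x ∧ g n = y ∧ ∀ i < n, R (g i) (g (i + 1))

theorem WalkN.trans {R : V → V → Prop} {m n : ℕ} {x y z : V} (h1 : WalkN R m x y)
    (h2 : WalkN R n y z) : WalkN R (m + n) x z := by
  obtain ⟨g, g0, gm, hg⟩ := h1
  obtain ⟨k, k0, kn, hk⟩ := h2
  refine ⟨fun i => if i < m then g i else k (i - m), ?_, ?_, ?_⟩
  · by_cases h : 0 < m
    · simp [h, g0]
    · have : m = 0 := by omega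
      subst this
      simp [k0, ← gm, g0]
  · simp [kn]
  · intro i hi
    rcases lt_trichotomy (i + 1) m with h | h | h
    · have : i < m := by omega
      simp only [this, h, if_true]
      exact hg i this
    · have h3 : i < m := by omega
      have h4 : ¬ i + 1 < m := by omega
      simp only [h3, h4, if_true, if_false]
      have := hg i h3
      rw [h, gm] at this
      rw [h, Nat.sub_self, k0]
      exact this
    · have h3 : ¬ i < m := by omega
      have h4 : ¬ i + 1 < m := by omega
      simp only [h3, h4, if_false]
      have := hk (i - m) (by omega)
      rwa [show i - m + 1 = i + 1 - m by omega] at this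

theorem WalkN.one {R : V → V → Prop} {x y : V} (h : R x y) : WalkN R 1 x y :=
  ⟨fun i => if i = 0 then x else y, by simp, by simp, by
    intro i hi
    have : i = 0 := by omega
    subst this
    simpa using h⟩

theorem WalkN.sub {R : V → V → Prop} {n : ℕ} {g : ℕ → V} (hg : ∀ i < n, R (g i) (g (i + 1)))
    {i j : ℕ} (hij : i ≤ j) (hj : j ≤ n) : WalkN R (j - i) (g i) (g j) := by
  refine ⟨fun k => g (i + k), by simp, by simp [hij], ?_⟩
  intro k hk
  exact hg (i + k) (by omega)

theorem exists_walkN {R : V → V → Prop} {x y : V} (h : Relation.TransGen R x y) :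
    ∃ n, 0 < n ∧ WalkN R n x y := by
  induction h with
  | single h => exact ⟨1, one_pos, .one h⟩
  | tail _ h ih =>
    obtain ⟨n, hn, hw⟩ := ih
    exact ⟨n + 1, by omega, hw.trans (.one h)⟩

theorem chordal {A : Set (V × V)} {f : V → ℕ} (hf : ∀ {x y}, (x, y) ∈ A → f x < f y)
    (hF : Filled A) (hV : Vertebrate A) {E : V → V → Prop}
    (hE : ∀ x y, (E x y ∨ E y x) ↔ ((x, y) ∈ A ∨ (y, x) ∈ A))
    (h2 : ∀ x y, E x y → ¬ E y x)
    (h3 : ∀ x y z, E x y → E y z → ¬ E z x) (v : V) : ¬ Relation.TransGen E v v := by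
  intro hcyc
  have hP : ∃ n, 0 < n ∧ ∃ x, WalkN E n x x := by
    obtain ⟨n, h, h'⟩ := exists_walkN hcyc
    exact ⟨n, h, _, h'⟩
  classical
  obtain ⟨hn, x, g, g0, gn, hg⟩ := Nat.find_spec hP
  have hmin : ∀ m x, 0 < m → WalkN E m x x → Nat.find hP ≤ m := fun m x h h' =>
    Nat.find_min' hP ⟨h, x, h'⟩
  generalize Nat.find hP = n at hn gn hg hmin
  have irr : ∀ x, ¬ E x x := fun x h => h2 x x h h
  have hn4 : 4 ≤ n := by
    by_contra h
    have : n = 1 ∨ n = 2 ∨ n = 3 := by omega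
    rcases this with rfl | rfl | rfl
    · have := hg 0 (by omega)
      simp only [zero_add] at this
      rw [g0, gn] at this
      exact irr _ this
    · have e1 := hg 0 (by omega)
      have e2 := hg 1 (by omega)
      simp only [zero_add, Nat.reduceAdd] at e1 e2
      rw [g0] at e1
      rw [gn] at e2
      exact h2 _ _ e1 e2
    · have e1 := hg 0 (by omega)
      have e2 := hg 1 (by omega)
      have e3 := hg 2 (by omega)
      simp only [zero_add, Nat.reduceAdd] at e1 e2 e3
      rw [g0] at e1
      rw [gn] at e3
      exact h3 _ _ _ e1 e2 e3
  have inj : ∀ i j, i < j → j < n → g i ≠ g j := by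
    intro i j hij hj he
    have := WalkN.sub hg hij.le hj.le
    rw [← he] at this
    have := hmin _ _ (by omega) this
    omega
  have back : ∀ i j, i < j → j < n → E (g j) (g i) → i = 0 ∧ j = n - 1 := by
    intro i j hij hj he
    have := hmin _ _ (by omega) ((WalkN.sub hg hij.le hj.le).trans (.one he))
    omega
  have forw : ∀ i j, i < j → j < n → E (g i) (g j) → j = i + 1 := by
    intro i j hij hj he
    have w1 := WalkN.sub hg (Nat.zero_le i) (hij.le.trans hj.le)
    have w2 := WalkN.sub hg hj.le le_rfl
    rw [g0] at w1
    rw [gn] at w2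
    have := hmin _ _ (by omega) ((w1.trans (.one he)).trans w2)
    omega
  have adj : ∀ i j, i < j → j < n → ((g i, g j) ∈ A ∨ (g j, g i) ∈ A) →
      j = i + 1 ∨ (i = 0 ∧ j = n - 1) := by
    intro i j hij hj h
    rcases (hE _ _).2 h with h | h
    · exact Or.inl (forw i j hij hj h)
    · exact Or.inr (back i j hij hj h)
  have adj' : ∀ i j, i < n → j < n → ((g i, g j) ∈ A ∨ (g j, g i) ∈ A) →
      j = i + 1 ∨ i = j + 1 ∨ (i = 0 ∧ j = n - 1) ∨ (j = 0 ∧ i = n - 1) := by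
    intro i j hi hj h
    rcases lt_trichotomy i j with h' | h' | h'
    · have := adj i j h' hj h
      omega
    · subst h'
      have := h.elim hf hf
      omega
    · have := adj j i h' hi h.symm
      omega
  set U : Set V := {x | ∃ i < n, g i = x} with hU
  have edge : ∀ i j, i < n → j < n → ((g i, g j) ∈ A ∨ (g j, g i) ∈ A) →
      (undirectedGraph (transRed (inducedArcs A U))).Adj (g i) (g j) := by
    have key : ∀ i j, i < n → j < n → (g i, g j) ∈ A →
        (g i, g j) ∈ transRed (inducedArcs A U) := by
      intro i j hi hj h
      refine transRed_induced hf hF h ⟨i, hi, rfl⟩ ⟨j, hj, rfl⟩ ?_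
      rintro w ⟨k, hk, rfl⟩ h4 h5
      have a1 := adj' i j hi hj (Or.inl h)
      have a2 := adj' i k hi hk (Or.inl h4)
      have a3 := adj' k j hk hj (Or.inl h5)
      omega
    intro i j hi hj h
    rw [undirectedGraph, SimpleGraph.fromRel_adj]
    refine ⟨?_, h.imp (key i j hi hj) (key j i hj hi)⟩
    intro he
    rw [he] at h
    have := h.elim hf hf
    omega
  have eg : ∀ i < n, ((g i, g (i + 1)) ∈ A ∨ (g (i + 1), g i) ∈ A) := fun i hi =>
    (hE _ _).1 (Or.inl (hg i hi))
  have elast := eg (n - 1) (by omega)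
  rw [show n - 1 + 1 = n by omega, gn, ← g0] at elast
  have e0 := edge 0 (n - 1) (by omega) (by omega) elast.symm
  refine not_bridge (hV U) e0 ?_
  have reach : ∀ k, k < n → ((undirectedGraph (transRed (inducedArcs A U))).deleteEdges
      {s(g 0, g (n - 1))}).Reachable (g 0) (g k) := by
    intro k
    induction k with
    | zero => exact fun _ => .refl _
    | succ k ih =>
      intro hk
      refine (ih (by omega)).trans (SimpleGraph.Adj.reachable ?_)
      rw [SimpleGraph.deleteEdges_adj]
      refine ⟨edge k (k + 1) (by omega) hk (eg k (by omega)), ?_⟩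
      simp only [Set.mem_singleton_iff, Sym2.eq_iff]
      rintro (⟨h4, h5⟩ | ⟨h4, h5⟩)
      · have c1 : k = 0 := by
          by_contra hne
          exact inj 0 k (by omega) (by omega) h4.symm
        exact inj (k + 1) (n - 1) (by omega) (by omega) h5
      · exact inj 0 (k + 1) (by omega) (by omega) h5.symm
  exact reach (n - 1) (by omega)

theorem exists_Sk [Fintype V] {A : Set (V × V)} (hA : IsDAG A) (hS : Skeletal A) :
    ∃ f : V → ℕ, Sk A f := by
  obtain ⟨f, hf⟩ := exists_rank hA.2.2
  refine ⟨f, hf, ?_, ?_⟩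
  · intro u v huv x y h1 h2 h3 h4
    rcases fill hf hS.2 huv h1 h2 with rfl | rfl | hx
    · rcases fill hf hS.2 huv h3 h4 with rfl | rfl | hy
      · exact Or.inl rfl
      · exact Or.inr (Or.inl huv)
      · exact Or.inr (Or.inl hy.1)
    · rcases fill hf hS.2 huv h3 h4 with rfl | rfl | hy
      · exact Or.inr (Or.inr huv)
      · exact Or.inl rfl
      · exact Or.inr (Or.inr hy.2)
    · rcases fill hf hS.2 huv h3 h4 with rfl | rfl | hy
      · exact Or.inr (Or.inr hx.1)
      · exact Or.inr (Or.inl hx.2)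
      · exact clique4 hf hS.2 hS.1 hx.1 hx.2 hy.1 hy.2
  · intro B hB hc hcc
    have mE : ∀ x y, ArcRel (reorient A B) x y ↔ ((x, y) ∈ A ∧ (x, y) ∉ B) ∨ (y, x) ∈ B := by
      intro x y
      simp [ArcRel, reorient]
    have asy : ∀ a b, (a, b) ∈ A → (b, a) ∉ A := fun a b h h' => lt_asymm (hf h) (hf h')
    refine ⟨hB, chordal hf hS.2 hS.1 ?_ ?_ ?_⟩
    · intro x y
      rw [mE, mE]
      have g1 : (x, y) ∈ B → (x, y) ∈ A := @hB _
      have g2 : (y, x) ∈ B → (y, x) ∈ A := @hB _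
      tauto
    · intro x y
      rw [mE, mE]
      have g1 : (x, y) ∈ B → (x, y) ∈ A := @hB _
      have g2 : (y, x) ∈ B → (y, x) ∈ A := @hB _
      have := asy x y
      tauto
    · have cyc : ∀ a b c, (a, b) ∈ A → (b, c) ∈ A → (c, a) ∈ A → False := by
        intro a b w h1 h2 h3
        have := hf h1
        have := hf h2
        have := hf h3
        omega
      intro x y z
      rw [mE, mE, mE]
      rintro (⟨a1, b1⟩ | a1) (⟨a2, b2⟩ | a2) (⟨a3, b3⟩ | a3)
      · exact cyc _ _ _ a1 a2 a3
      · exact (hcc _ _ _ a1 a2 a3).elim b1 b2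
      · exact (hcc _ _ _ a3 a1 a2).elim b3 b1
      · exact b1 (hc _ _ _ a3 a2 a1)
      · exact (hcc _ _ _ a2 a3 a1).elim b2 b3
      · exact b2 (hc _ _ _ a1 a3 a2)
      · exact b3 (hc _ _ _ a2 a1 a3)
      · exact cyc _ _ _ (hB a2) (hB a1) (hB a3)

end skeletal
section final

variable {V : Type*} {A : Set (V × V)} {f : V → ℕ}

theorem Sk.erase_mem (s : Sk A f) {B : Set (V × V)} (hB : ARmem A B) {u v : V}
    (hred : (v, u) ∈ transRed (reorient A B)) (huv : (u, v) ∈ B) : ARmem A (B \ {(u, v)}) := by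
  have hsub := hB.1
  have hno : ∀ w, ArcRel (reorient A B) v w → ArcRel (reorient A B) w u → False :=
    fun w h1 h2 => hred.2 ⟨w, h1, .single h2⟩
  have inB : ∀ {x y}, (x, y) ∈ B → ArcRel (reorient A B) y x := fun h => Or.inr ⟨_, h, rfl⟩
  have inA : ∀ {x y}, (x, y) ∈ A → (x, y) ∉ B → ArcRel (reorient A B) x y :=
    fun h h' => Or.inl ⟨h, h'⟩
  refine s.tri (fun a h => hsub h.1) ?_ ?_
  · intro x y z h1 h2 h3
    refine ⟨hB.closed h1.1 h2.1 h3, ?_⟩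
    intro he
    simp only [Set.mem_singleton_iff, Prod.mk.injEq] at he
    obtain ⟨rfl, rfl⟩ := he
    exact hno y (inB h2.1) (inB h1.1)
  · intro x y z h1 h2 h3
    by_contra! h4
    by_cases e1 : (x, y) = (u, v)
    · obtain ⟨rfl, rfl⟩ := Prod.mk.injEq .. ▸ e1
      by_cases hyz : (y, z) ∈ B
      · refine h4.2 ⟨hyz, ?_⟩
        intro he
        simp only [Set.mem_singleton_iff, Prod.mk.injEq] at he
        have := s.lt h1
        rw [he.1] at this
        omega
      · exact hno z (inA h2 hyz) (inB h3.1)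
    · have hxy : (x, y) ∉ B := fun h => h4.1 ⟨h, e1⟩
      by_cases e2 : (y, z) = (u, v)
      · obtain ⟨rfl, rfl⟩ := Prod.mk.injEq .. ▸ e2
        exact hno x (inB h3.1) (inA h1 hxy)
      · exact (hB.coclosed h1 h2 h3.1).elim hxy fun h => h4.2 ⟨h, e2⟩

theorem Sk.erase_eq (s : Sk A f) {J Jst : ARP A} (hJu : ∀ C : ARP A, C ⋖ J → C = Jst) {u v : V}
    (hred : (v, u) ∈ transRed (reorient A J.1)) (huv : (u, v) ∈ J.1) :
    Jst.1 = J.1 \ {(u, v)} := by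
  have h := s.erase_mem J.2 hred huv
  rw [← hJu ⟨_, h⟩]
  have hlt : (⟨_, h⟩ : ARP A) < J := by
    refine lt_of_le_of_ne (fun a ha => ha.1) ?_
    intro he
    have : (u, v) ∈ (⟨_, h⟩ : ARP A).1 := by rw [he]; exact huv
    exact this.2 rfl
  refine ⟨hlt, ?_⟩
  intro c hc hc'
  by_cases hm : (u, v) ∈ c.1
  · refine hc'.not_ge ?_
    intro a ha
    by_cases e : a = (u, v)
    · rw [e]; exact hm
    · exact hc.le ⟨ha, e⟩
  · refine hc.not_ge ?_
    intro a ha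
    refine ⟨hc'.le ha, ?_⟩
    rintro rfl
    exact hm ha

theorem delta_cases {B : Set (V × V)} (hB : ARmem A B) {u v : V}
    (hred : (v, u) ∈ transRed (reorient A B)) (huv : (u, v) ∈ B) {w : V} (h1 : (u, w) ∈ A)
    (h2 : (w, v) ∈ A) : w ∈ deltaDown A B u v ∨ w ∈ deltaUp A B u v := by
  by_cases g1 : (u, w) ∈ B
  · refine Or.inl ⟨g1, h2, fun g2 => ?_⟩
    exact hred.2 ⟨w, Or.inr ⟨_, g2, rfl⟩, .single (Or.inr ⟨_, g1, rfl⟩)⟩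
  · exact Or.inr ⟨⟨h1, g1⟩, (hB.coclosed h1 h2 huv).resolve_left g1⟩

theorem Sk.KK_sub (s : Sk A f) {B : Set (V × V)} (hB : ARmem A B) {u v : V}
    (hred : (v, u) ∈ transRed (reorient A B)) (huv : (u, v) ∈ B) :
    KK A u v (deltaDown A B u v) ⊆ B := by
  rintro ⟨x, y⟩ h
  obtain ⟨h1, h2, h3, h4, h5⟩ := mem_KK.1 h
  have hA := hB.1 huv
  have l1 := s.lt h1
  have l2 := s.le h2
  have l3 := s.le h3
  have huy : (u, y) ∈ B := by
    rcases h5 with rfl | h5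
    · exact huv
    · exact h5.1
  rcases eq_or_ne x u with rfl | hne
  · exact huy
  have hux : (u, x) ∈ A := s.arc hA .refl h2 (h3.head h1) hne.symm
  have hxv : (x, v) ∈ A := s.arc hA h2 (h3.head h1) .refl (by grind)
  have hup := (delta_cases hB hred huv hux hxv).resolve_left (h4.resolve_left hne)
  exact (hB.coclosed hux h1 huy).resolve_left hup.1.2

/-- The rope subrelation agrees with the encoded one. -/
theorem Sk.subrope_iff (s : Sk A f) {B B' : Set (V × V)} (hB : ARmem A B) (hB' : ARmem A B')
    {u v u' v' : V} (hred : (v, u) ∈ transRed (reorient A B)) (huv : (u, v) ∈ B)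
    (hred' : (v', u') ∈ transRed (reorient A B')) (huv' : (u', v') ∈ B') :
    Subrope ⟨u, v, deltaDown A B u v, deltaUp A B u v⟩
      ⟨u', v', deltaDown A B' u' v', deltaUp A B' u' v'⟩ ↔
    SubR A u v (deltaDown A B u v) u' v' (deltaDown A B' u' v') := by
  have hA := hB.1 huv
  have hA' := hB'.1 huv'
  have luv := s.lt hA
  have dd : ∀ {w}, w ∈ deltaDown A B' u' v' → (u', w) ∈ A ∧ (w, v') ∈ A := fun h =>
    ⟨hB'.1 h.1, h.2.1⟩
  have du : ∀ {w}, w ∈ deltaUp A B' u' v' → (u', w) ∈ A ∧ (w, v') ∈ A := fun h =>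
    ⟨h.1.1, hB'.1 h.2⟩
  have bet : ∀ w, w ∈ ({u', v'} : Set V) ∪ deltaDown A B' u' v' ∪ deltaUp A B' u' v' →
      Le A u' w ∧ Le A w v' := by
    rintro w (((h | h) | h) | h)
    · rw [h]; exact ⟨.refl, Le.single hA'⟩
    · rw [Set.mem_singleton_iff.1 h]; exact ⟨Le.single hA', .refl⟩
    · exact ⟨Le.single (dd h).1, Le.single (dd h).2⟩
    · exact ⟨Le.single (du h).1, Le.single (du h).2⟩
  have bet' : ∀ w, Le A u' w → Le A w v' →
      w ∈ ({u', v'} : Set V) ∪ deltaDown A B' u' v' ∪ deltaUp A B' u' v' := by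
    intro w h1 h2
    by_cases e1 : w = u'
    · exact Or.inl (Or.inl (Or.inl e1))
    by_cases e2 : w = v'
    · exact Or.inl (Or.inl (Or.inr e2))
    rcases delta_cases hB' hred' huv' (s.arc hA' .refl h1 h2 (Ne.symm e1))
      (s.arc hA' h1 h2 .refl e2) with h | h
    · exact Or.inl (Or.inr h)
    · exact Or.inr h
  constructor
  · rintro ⟨h1, h2, h3⟩
    refine ⟨(bet u (h1 (Or.inl rfl))).1, (bet v (h1 (Or.inr rfl))).2, ?_⟩
    intro w g1 g2
    refine ⟨fun h => h2 h, fun h => ?_⟩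
    rcases delta_cases hB hred huv g1 g2 with k | k
    · exact k
    · exact absurd h.1 (h3 k).1.2
  · rintro ⟨h1, h2, h3⟩
    refine ⟨?_, ?_, ?_⟩
    · rintro w (rfl | h)
      · exact bet' _ h1 (h2.head hA)
      · rw [Set.mem_singleton_iff.1 h]; exact bet' _ (h1.tail hA) h2
    · intro w h
      exact (h3 w (hB.1 h.1) h.2.1).1 h
    · intro w h
      have k1 : (u, w) ∈ A := h.1.1
      have k2 : (w, v) ∈ A := hB.1 h.2
      have hn : w ∉ deltaDown A B' u' v' := fun h' => h.1.2 ((h3 w k1 k2).2 h').1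
      have l1 := s.lt k1
      have l2 := s.lt k2
      have l3 := s.le h1
      have l4 := s.le h2
      rcases bet' w (h1.tail k1) (h2.head k2) with ((e | e) | e) | e
      · rw [e] at l1; grind
      · rw [Set.mem_singleton_iff.1 e] at l2; grind
      · exact absurd e hn
      · exact e

theorem Sk.main (s : Sk A f) {J Jst J' Jst' : ARP A}
    (hJu : ∀ C : ARP A, C ⋖ J → C = Jst) (hJu' : ∀ C : ARP A, C ⋖ J' → C = Jst')
    {u v u' v' : V}
    (huv : (u, v) ∈ J.1) (huvred : (v, u) ∈ transRed (reorient A J.1))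
    (huv' : (u', v') ∈ J'.1) (huvred' : (v', u') ∈ transRed (reorient A J'.1)) :
    (∀ r : ARP A → ARP A → Prop, IsCong A r → r J Jst → r J' Jst') ↔
    SubR A u v (deltaDown A J.1 u v) u' v' (deltaDown A J'.1 u' v') := by
  have eJ := s.erase_eq hJu huvred huv
  have eJ' := s.erase_eq hJu' huvred' huv'
  have hA := J.2.1 huv
  have hA' := J'.2.1 huv'
  have hK := s.KK_sub J.2 huvred huv
  have hK' := s.KK_sub J'.2 huvred' huv'
  constructor
  · intro H
    have h1 := H _ (s.rcon_cong u v (deltaDown A J.1 u v)) (by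
      intro u2 v2 D2 hA2 hn
      rw [eJ]
      refine ⟨fun h => ?_, fun h a ha => (h ha).1⟩
      rintro a ha
      refine ⟨h ha, ?_⟩
      rintro rfl
      obtain ⟨g1, g2, g3, g4, g5⟩ := mem_KK.1 ha
      refine hn ⟨g2, g3, ?_⟩
      intro w k1 k2
      constructor
      · intro hw
        by_contra hw2
        exact hw.2.2 (h (mem_KK.2 ⟨k2, g2.tail k1, g3, Or.inr hw2, g5⟩))
      · intro hw2
        rcases delta_cases J.2 huvred huv k1 k2 with hw | hw
        · exact hw
        · exact absurd (h (mem_KK.2 ⟨k1, g2, g3.head k2, g4, Or.inr hw2⟩)) hw.1.2)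
    by_contra hn
    have h2 := (h1 u' v' _ hA' hn).1 hK' (self_mem_KK hA')
    rw [eJ'] at h2
    exact h2.2 rfl
  · rintro ⟨h1, h2, h3⟩ r hr hrJ
    have c1 : s.C r hA (deltaDown A J.1 u v) := by
      refine hr.2.2 _ _ _ _ _ _ hrJ (hr.1.refl (s.K hA (deltaDown A J.1 u v))) ?_ ?_
      · constructor
        · rintro Z (rfl | rfl)
          · exact hK
          · exact le_rfl
        · exact fun Z hZ => hZ (Or.inr rfl)
      · constructor
        · rintro Z (rfl | rfl)
          · intro a ha
            rw [eJ]
            exact ⟨hK ha.1, ha.2⟩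
          · exact fun a ha => ha.1
        · intro Z hZ a ha
          have k1 : Z.1 ⊆ Jst.1 := hZ (Or.inl rfl)
          have k2 : Z.1 ⊆ KK A u v _ := hZ (Or.inr rfl)
          rw [eJ] at k1
          exact ⟨k2 ha, (k1 ha).2⟩
    have c2 : s.C r hA (deltaDown A J'.1 u' v') := by
      have e := s.KK_congr hA h3
      unfold Sk.C Sk.K Sk.Kst at c1 ⊢
      simpa only [e] using c1
    have c3 := s.C_step hr hA hA' h1 h2 c2
    refine hr.2.1 _ _ _ _ _ _ c3 (hr.1.refl Jst') ?_ ?_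
    · constructor
      · rintro Z (rfl | rfl)
        · exact hK'
        · intro a ha
          rw [eJ'] at ha
          exact ha.1
      · intro Z hZ a ha
        have k1 : KK A u' v' _ ⊆ Z.1 := hZ (Or.inl rfl)
        have k2 : Jst'.1 ⊆ Z.1 := hZ (Or.inr rfl)
        by_cases e : a = (u', v')
        · rw [e]; exact k1 (self_mem_KK hA')
        · refine k2 ?_
          rw [eJ']
          exact ⟨ha, e⟩
    · constructor
      · rintro Z (rfl | rfl)
        · intro a ha
          rw [eJ']
          exact ⟨hK' ha.1, ha.2⟩
        · exact le_rfl
      · exact fun Z hZ => hZ (Or.inr rfl)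

end final

/-- Forcing between join irreducibles of the acyclic
reorientation lattice corresponds to the subrope relation. -/
theorem stmt_18 {V : Type*} [Fintype V] (A : Set (V × V)) (hA : IsDAG A)
    (hS : Skeletal A) (J Jst J' Jst' : ARP A)
    (hJ : Jst ⋖ J) (hJu : ∀ C : ARP A, C ⋖ J → C = Jst)
    (hJ' : Jst' ⋖ J') (hJu' : ∀ C : ARP A, C ⋖ J' → C = Jst')
    (u v u' v' : V)
    (huv : (u, v) ∈ J.1) (huvred : (v, u) ∈ transRed (reorient A J.1))
    (huv' : (u', v') ∈ J'.1) (huvred' : (v', u') ∈ transRed (reorient A J'.1)) :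
    (∀ r : ARP A → ARP A → Prop, IsCong A r → r J Jst → r J' Jst') ↔
    Subrope ⟨u, v, deltaDown A J.1 u v, deltaUp A J.1 u v⟩
      ⟨u', v', deltaDown A J'.1 u' v', deltaUp A J'.1 u' v'⟩ := by
  obtain ⟨f, s⟩ := exists_Sk hA hS
  rw [s.subrope_iff J.2 J'.2 huvred huv huvred' huv']
  exact s.main hJu hJu' huv huvred huv' huvred'
end
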